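/- For every integer k ≥ 1 there exist finite positive constants Δ_k and C_k (depending only on k) such that the following holds: for any k distinct real numbers X = (x_1, …, x_k) and any partition of the index set {1,…,k} into nonempty disjoint sets I and J, if d = min{|x_i − x_j| : i ∈ I, j ∈ J} ≥ 2Δ_k, then | ρ_k(X) / (ρ_{|I|}(X_I) · ρ_{|J|}(X_J)) − 1 | ≤ C_k exp(−(d − Δ_k)²/2), where X_I = (x_i)_{i ∈ I}, X_J = (x_j)_{j ∈ J}, and ρ_m denotes the m-point correlation function of the real zeros of the Weyl series P_∞. -/

import Mathlib

open MeasureTheory ProbabilityTheory Real Filter Topology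
open scoped BigOperators Classical

noncomputable section

/-- The Weyl polynomial `P_n(x) = ∑_{k=0}^n ξ_k x^k / √(k!)` as a `Polynomial ℝ`. -/
def weylPoly {Ω : Type*} (ξ : ℕ → Ω → ℝ) (n : ℕ) (ω : Ω) : Polynomial ℝ :=
  ∑ k ∈ Finset.range (n + 1),
    Polynomial.C (ξ k ω / Real.sqrt (Nat.factorial k)) * Polynomial.X ^ k

/-- The Weyl series `P_∞(x) = ∑_{k=0}^∞ ξ_k x^k / √(k!)`. -/
def weylSeries {Ω : Type*} (ξ : ℕ → Ω → ℝ) (ω : Ω) (x : ℝ) : ℝ :=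
  ∑' k : ℕ, ξ k ω * x ^ k / Real.sqrt (Nat.factorial k)

/-- Covariance of the 2-jet of the Weyl series at points `s`, `t`:
`weylCov s t a b = E[P_∞^{(a)}(s) P_∞^{(b)}(t)]` for `a b : Fin 2`,
computed from the covariance kernel `E[P_∞(s)P_∞(t)] = e^{st}`. -/
def weylCov (s t : ℝ) (a b : Fin 2) : ℝ :=
  (if a = 0 then (if b = 0 then 1 else s) else (if b = 0 then t else 1 + s * t)) *
    Real.exp (s * t)

/-- The covariance matrix `Γ` of `(P_∞(x_1), P_∞'(x_1), …, P_∞(x_k), P_∞'(x_k))`. -/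
def weylGamma {k : ℕ} (x : Fin k → ℝ) :
    Matrix (Fin k × Fin 2) (Fin k × Fin 2) ℝ :=
  fun p q => weylCov (x p.1) (x q.1) p.2 q.2

/-- The vector `η = (0, η_1, 0, η_2, …, 0, η_k) ∈ ℝ^{2k}`. -/
def weylEta {k : ℕ} (η : Fin k → ℝ) : Fin k × Fin 2 → ℝ :=
  fun p => if p.2 = 1 then η p.1 else 0

/-- The `k`-point correlation function of the real zeros of the Weyl series, given by the
Kac–Rice formula `ρ_k(x) = (2π)^{-k} |det Γ|^{-1/2} ∫_{ℝ^k} |η_1⋯η_k| exp(-½⟨Γ⁻¹η, η⟩) dη`. -/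
def weylRho (k : ℕ) (x : Fin k → ℝ) : ℝ :=
  ((2 * Real.pi) ^ k)⁻¹ * (Real.sqrt |(weylGamma x).det|)⁻¹ *
    ∫ η : Fin k → ℝ,
      (∏ i, |η i|) *
        Real.exp (-(1 / 2) *
          ∑ p, (weylGamma x)⁻¹.mulVec (weylEta η) p * weylEta η p)

/-- The constant `K = 1/π + ∫_ℝ (ρ₂(0,t) − 1/π²) dt`. -/
def weylK : ℝ :=
  1 / Real.pi + ∫ t : ℝ, (weylRho 2 ![0, t] - 1 / Real.pi ^ 2)

/-- The interval `I_n = [−√n + n^{1/6} log n, √n − n^{1/6} log n]`. -/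
def weylIntvl (n : ℕ) : Set ℝ :=
  Set.Icc (-Real.sqrt n + (n : ℝ) ^ ((1 : ℝ) / 6) * Real.log n)
    (Real.sqrt n - (n : ℝ) ^ ((1 : ℝ) / 6) * Real.log n)

open Polynomial in
/-- Coefficient bound for `∏ (1 - r i X)`. -/
lemma abs_coeff_prod_one_sub_le {ι : Type*} (s : Finset ι) (r : ι → ℝ) {ρ : ℝ} (hρ : 0 ≤ ρ)
    (hr : ∀ i ∈ s, |r i| ≤ ρ) (j : ℕ) :
    |(∏ i ∈ s, (1 - C (r i) * X) : ℝ[X]).coeff j| ≤ 2 ^ s.card * ρ ^ j := by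
  classical
  induction s using Finset.induction_on generalizing j with
  | empty =>
    rcases j with _ | j
    · simp
    · simp [coeff_one]; positivity
  | insert a s ha ih =>
    have ih' := ih (fun i hi => hr i (Finset.mem_insert_of_mem hi))
    have hra := hr a (Finset.mem_insert_self a s)
    rw [Finset.prod_insert ha, Finset.card_insert_of_notMem ha, sub_mul, one_mul, coeff_sub,
      mul_assoc, coeff_C_mul]
    rcases j with _ | j
    · have := ih' 0
      simp only [coeff_X_mul_zero, mul_zero, sub_zero]
      refine this.trans ?_
      simp only [pow_zero, mul_one, pow_succ]
      linarith [pow_pos (two_pos : (0 : ℝ) < 2) s.card]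
    · rw [coeff_X_mul]
      have h1 := ih' (j + 1)
      have h2 := ih' j
      calc _ ≤ |(∏ i ∈ s, (1 - C (r i) * X) : ℝ[X]).coeff (j + 1)| +
            |r a * (∏ i ∈ s, (1 - C (r i) * X) : ℝ[X]).coeff j| := abs_sub _ _
        _ ≤ 2 ^ s.card * ρ ^ (j + 1) + ρ * (2 ^ s.card * ρ ^ j) := by
            rw [abs_mul]; gcongr
        _ = _ := by ring

/-- Coefficient bound for the inverse power series of `∏ (1 - r i X)`. -/
lemma abs_coeff_prod_geom_le {ι : Type*} (s : Finset ι) (r : ι → ℝ) {ρ : ℝ} (hρ : 0 ≤ ρ)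
    (hr : ∀ i ∈ s, |r i| ≤ ρ) (j : ℕ) :
    |PowerSeries.coeff j (∏ i ∈ s, PowerSeries.mk (fun n => r i ^ n))| ≤
      (j + 1 : ℝ) ^ s.card * ρ ^ j := by
  classical
  induction s using Finset.induction_on generalizing j with
  | empty =>
    rcases j with _ | j
    · simp
    · simp [PowerSeries.coeff_one]; positivity
  | insert a s ha ih =>
    have ih' := ih (fun i hi => hr i (Finset.mem_insert_of_mem hi))
    have hra := hr a (Finset.mem_insert_self a s)
    rw [Finset.prod_insert ha, Finset.card_insert_of_notMem ha, PowerSeries.coeff_mul]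
    calc _ ≤ ∑ p ∈ Finset.HasAntidiagonal.antidiagonal j, |PowerSeries.coeff p.1 (PowerSeries.mk fun n => r a ^ n) *
          PowerSeries.coeff p.2 (∏ i ∈ s, PowerSeries.mk (fun n => r i ^ n))| :=
            Finset.abs_sum_le_sum_abs _ _
      _ ≤ ∑ p ∈ Finset.HasAntidiagonal.antidiagonal j, (j + 1 : ℝ) ^ s.card * ρ ^ j := by
          refine Finset.sum_le_sum fun p hp => ?_
          have hpj : p.1 + p.2 = j := Finset.HasAntidiagonal.mem_antidiagonal.1 hp
          have h2 : (p.2 : ℝ) ≤ j := by exact_mod_cast (by omega)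
          rw [abs_mul, PowerSeries.coeff_mk, abs_pow]
          calc _ ≤ ρ ^ p.1 * ((p.2 + 1 : ℝ) ^ s.card * ρ ^ p.2) := by
                gcongr; exact ih' _
            _ = (p.2 + 1 : ℝ) ^ s.card * ρ ^ j := by rw [← hpj, pow_add]; ring
            _ ≤ _ := by gcongr
      _ = _ := by
          rw [Finset.sum_const, Finset.Nat.card_antidiagonal, nsmul_eq_mul, pow_succ]
          push_cast; ring

open Polynomial in
/-- A multiple of `∏ (1 - r i X)` of the form `1 + O(X ^ n)` with small coefficients and degree
less than `n + #s`. -/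
lemma exists_multiple_one_add_gap {ι : Type*} (s : Finset ι) (r : ι → ℝ) {ρ : ℝ} (hρ : 0 ≤ ρ)
    (hr : ∀ i ∈ s, |r i| ≤ ρ) {n : ℕ} (hn : 0 < n) :
    ∃ h : ℝ[X], (∏ i ∈ s, (1 - C (r i) * X)) ∣ h ∧ h.coeff 0 = 1 ∧
      (∀ j, 0 < j → j < n → h.coeff j = 0) ∧ (∀ j, n + s.card ≤ j → h.coeff j = 0) ∧
      ∀ j, |h.coeff j| ≤ 2 ^ s.card * (n + s.card : ℝ) ^ (s.card + 1) * ρ ^ j := by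
  set D : ℝ[X] := ∏ i ∈ s, (1 - C (r i) * X) with hD
  set G : PowerSeries ℝ := ∏ i ∈ s, PowerSeries.mk (fun n => r i ^ n) with hG
  have hDG : (D : PowerSeries ℝ) * G = 1 := by
    rw [hD, hG, ← coeToPowerSeries.ringHom_apply, map_prod, ← Finset.prod_mul_distrib]
    refine Finset.prod_eq_one fun i _ => ?_
    ext j
    simp only [coeToPowerSeries.ringHom_apply, coe_one, coe_mul, coe_C, coe_X, sub_mul,
      one_mul, mul_assoc, map_sub, PowerSeries.coeff_C_mul, PowerSeries.coeff_one]
    rcases j with _ | j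
    · simp
    · simp [PowerSeries.coeff_succ_X_mul, pow_succ']
  have hcoeff : ∀ j, (D * PowerSeries.trunc n G).coeff j =
      ∑ p ∈ Finset.HasAntidiagonal.antidiagonal j, D.coeff p.1 * (if p.2 < n then PowerSeries.coeff p.2 G else 0) := by
    intro j
    rw [coeff_mul]
    exact Finset.sum_congr rfl fun p _ => by rw [PowerSeries.coeff_trunc]
  have hlow : ∀ j, j < n → (D * PowerSeries.trunc n G).coeff j = if j = 0 then 1 else 0 := by
    intro j hj
    rw [hcoeff, ← PowerSeries.coeff_one (R := ℝ), ← hDG, PowerSeries.coeff_mul]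
    refine Finset.sum_congr rfl fun p hp => ?_
    have hpj : p.1 + p.2 = j := Finset.HasAntidiagonal.mem_antidiagonal.1 hp
    rw [if_pos (by omega), coeff_coe]
  have hdeg : D.natDegree ≤ s.card := by
    refine (natDegree_prod_le _ _).trans ?_
    refine (Finset.sum_le_card_nsmul _ _ 1 fun i _ => ?_).trans (by simp)
    compute_degree
  have hhigh : ∀ j, n + s.card ≤ j → (D * PowerSeries.trunc n G).coeff j = 0 := by
    intro j hj
    rw [hcoeff]
    refine Finset.sum_eq_zero fun p hp => ?_
    have hpj : p.1 + p.2 = j := Finset.HasAntidiagonal.mem_antidiagonal.1 hp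
    split_ifs with h
    · rw [coeff_eq_zero_of_natDegree_lt (by omega), zero_mul]
    · simp
  refine ⟨D * PowerSeries.trunc n G, dvd_mul_right _ _, by simp [hlow 0 hn],
    fun j h0 hj => by rw [hlow j hj, if_neg h0.ne'], hhigh, fun j => ?_⟩
  by_cases hj : n + s.card ≤ j
  · rw [hhigh j hj, abs_zero]; positivity
  rw [hcoeff]
  calc _ ≤ ∑ p ∈ Finset.HasAntidiagonal.antidiagonal j,
        |D.coeff p.1 * (if p.2 < n then PowerSeries.coeff p.2 G else 0)| :=
          Finset.abs_sum_le_sum_abs _ _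
    _ ≤ ∑ p ∈ Finset.HasAntidiagonal.antidiagonal j, 2 ^ s.card * (n + s.card : ℝ) ^ s.card * ρ ^ j := by
        refine Finset.sum_le_sum fun p hp => ?_
        have hpj : p.1 + p.2 = j := Finset.HasAntidiagonal.mem_antidiagonal.1 hp
        split_ifs with h
        · have h2 : (p.2 : ℝ) + 1 ≤ n + s.card := by
            have : (p.2 : ℝ) + 1 ≤ n := by exact_mod_cast h
            linarith [(Nat.cast_nonneg s.card : (0 : ℝ) ≤ s.card)]
          rw [abs_mul]
          calc _ ≤ (2 ^ s.card * ρ ^ p.1) * ((p.2 + 1 : ℝ) ^ s.card * ρ ^ p.2) := by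
                gcongr
                · exact abs_coeff_prod_one_sub_le s r hρ hr _
                · exact abs_coeff_prod_geom_le s r hρ hr _
            _ = 2 ^ s.card * (p.2 + 1 : ℝ) ^ s.card * ρ ^ j := by rw [← hpj, pow_add]; ring
            _ ≤ _ := by gcongr
        · rw [mul_zero, abs_zero]; positivity
    _ = (j + 1 : ℝ) * (2 ^ s.card * (n + s.card : ℝ) ^ s.card * ρ ^ j) := by
        rw [Finset.sum_const, Finset.Nat.card_antidiagonal, nsmul_eq_mul]
        push_cast; ring
    _ ≤ (n + s.card : ℝ) * (2 ^ s.card * (n + s.card : ℝ) ^ s.card * ρ ^ j) := by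
        refine mul_le_mul_of_nonneg_right ?_ (by positivity)
        exact_mod_cast (by omega : j + 1 ≤ n + s.card)
    _ = _ := by ring

/-- The translation operator `f ↦ f(· + τ)`. -/
def shiftEnd (τ : ℝ) : Module.End ℝ (ℝ → ℝ) := LinearMap.funLeft ℝ ℝ (· + τ)

lemma shiftEnd_apply (τ : ℝ) (f : ℝ → ℝ) (y : ℝ) : shiftEnd τ f y = f (y + τ) := rfl

lemma shiftEnd_pow_apply (τ : ℝ) (j : ℕ) (f : ℝ → ℝ) (y : ℝ) :
    (shiftEnd τ ^ j) f y = f (y + j * τ) := by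
  induction j generalizing y with
  | zero => simp
  | succ j ih =>
    rw [pow_succ', Module.End.mul_apply, shiftEnd_apply, ih]
    push_cast; ring_nf

lemma aeval_shiftEnd_apply (τ : ℝ) (p : Polynomial ℝ) {m : ℕ} (hp : ∀ j, m ≤ j → p.coeff j = 0)
    (f : ℝ → ℝ) (y : ℝ) :
    Polynomial.aeval (shiftEnd τ) p f y = ∑ j ∈ Finset.range m, p.coeff j * f (y + j * τ) := by
  rcases m.eq_zero_or_pos with rfl | hm
  · have : p = 0 := by ext j; simpa using hp j (Nat.zero_le _)
    simp [this]
  · rw [Polynomial.aeval_eq_sum_range' (n := m), LinearMap.sum_apply, Finset.sum_apply]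
    · refine Finset.sum_congr rfl fun j _ => ?_
      rw [LinearMap.smul_apply, Pi.smul_apply, shiftEnd_pow_apply, smul_eq_mul]
    · by_contra! h
      have := hp _ h
      rw [Polynomial.coeff_natDegree, Polynomial.leadingCoeff_eq_zero] at this
      simp [this] at h
      omega

lemma commute_shiftEnd (σ τ : ℝ) : Commute (shiftEnd σ) (shiftEnd τ) := by
  refine LinearMap.ext fun f => funext fun y => ?_
  simp only [Module.End.mul_apply, shiftEnd_apply]
  ring_nf

open Polynomial in
/-- `(1 - e^{-2sτ} S_τ)²` annihilates `(A + B t) e^{2 s t}`. -/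
lemma aeval_shiftEnd_exp_eq_zero (τ s A B r : ℝ) (hr : r = Real.exp (-(2 * s * τ))) (p : ℝ[X])
    (hp : (1 - C r * X) ^ 2 ∣ p) :
    aeval (shiftEnd τ) p (fun t => (A + B * t) * Real.exp (2 * s * t)) = 0 := by
  obtain ⟨q, rfl⟩ := hp
  have key : ∀ A B : ℝ, aeval (shiftEnd τ) (1 - C r * X)
      (fun t => (A + B * t) * Real.exp (2 * s * t)) =
      fun t => (-(B * τ) + 0 * t) * Real.exp (2 * s * t) := by
    intro A B
    funext t
    have h1 : Real.exp (2 * s * (t + τ)) = Real.exp (2 * s * t) * Real.exp (2 * s * τ) := by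
      rw [← Real.exp_add]; ring_nf
    have h2 : r * Real.exp (2 * s * τ) = 1 := by rw [hr, ← Real.exp_add]; simp
    simp only [map_sub, map_one, map_mul, aeval_C, aeval_X, LinearMap.sub_apply,
      Module.End.one_apply, Module.End.mul_apply, Pi.sub_apply, Module.algebraMap_end_apply,
      Pi.smul_apply, shiftEnd_apply, smul_eq_mul, h1]
    linear_combination (-(A + B * (t + τ)) * Real.exp (2 * s * t)) * h2
  rw [mul_comm, map_mul, Module.End.mul_apply, pow_two, map_mul, Module.End.mul_apply, key, key]
  have h0 : (fun t => (-(-(B * τ) * 0) + 0 * t) * Real.exp (2 * s * t)) = 0 := by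
    funext t; simp
  simp
  exact map_zero _

/-- A sum of exponentials with affine coefficients and rates `2 s i`. -/
def expSum {ι : Type*} [Fintype ι] (s A B : ι → ℝ) (t : ℝ) : ℝ :=
  ∑ i, (A i + B i * t) * Real.exp (2 * s i * t)

/-- If all rates satisfy `a ≤ |s i|`, the value of an exponential sum at `0` is expressed through
its values at far multiples of `τ`, with small coefficients. -/
lemma exists_expSum_relation {ι : Type*} [Fintype ι] (s : ι → ℝ) {a τ : ℝ} (hτ : 0 < τ)
    (has : ∀ i, a ≤ |s i|) {n N : ℕ} (hN : N = 2 * Fintype.card ι) (hn : 0 < n) :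
    ∃ c c' : ℕ → ℝ, c 0 = 1 ∧ c' 0 = 1 ∧ (∀ j, 0 < j → j < n → c j = 0) ∧
      (∀ l, 0 < l → l < n + N → c' l = 0) ∧
      (∀ j, |c j| ≤ 2 ^ N * (n + 2 * N : ℝ) ^ (N + 1) * Real.exp (-(2 * a * τ)) ^ j) ∧
      (∀ l, |c' l| ≤ 2 ^ N * (n + 2 * N : ℝ) ^ (N + 1) * Real.exp (-(2 * a * τ)) ^ l) ∧
      ∀ A B : ι → ℝ, ∑ p ∈ Finset.range (n + N) ×ˢ Finset.range (n + 2 * N),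
        c p.1 * c' p.2 * expSum s A B (((p.1 : ℝ) - p.2) * τ) = 0 := by
  set r : ι × Fin 2 → ℝ := fun i => if 0 ≤ s i.1 then Real.exp (-(2 * s i.1 * τ)) else 0 with hr
  set r' : ι × Fin 2 → ℝ := fun i => if 0 ≤ s i.1 then 0 else Real.exp (-(2 * s i.1 * -τ)) with hr'
  have hcard : (Finset.univ : Finset (ι × Fin 2)).card = N := by
    simp [hN, mul_comm]
  have hrρ : ∀ i ∈ Finset.univ, |r i| ≤ Real.exp (-(2 * a * τ)) := by
    intro i _
    have := has i.1
    simp only [hr]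
    split_ifs with h
    · rw [abs_of_pos (Real.exp_pos _), Real.exp_le_exp]
      rw [abs_of_nonneg h] at this
      nlinarith
    · rw [abs_zero]; positivity
  have hrρ' : ∀ i ∈ Finset.univ, |r' i| ≤ Real.exp (-(2 * a * τ)) := by
    intro i _
    have := has i.1
    simp only [hr']
    split_ifs with h
    · rw [abs_zero]; positivity
    · rw [abs_of_pos (Real.exp_pos _), Real.exp_le_exp]
      rw [abs_of_neg (not_le.1 h)] at this
      nlinarith
  obtain ⟨h, hdvd, h0, hgap, hdeg, hco⟩ :=
    exists_multiple_one_add_gap Finset.univ r (Real.exp_pos _).le hrρ hn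
  obtain ⟨h', hdvd', h0', hgap', hdeg', hco'⟩ :=
    exists_multiple_one_add_gap Finset.univ r' (Real.exp_pos _).le hrρ' (n := n + N) (by omega)
  rw [hcard] at hdeg hdeg' hco hco'
  refine ⟨h.coeff, h'.coeff, h0, h0', hgap, hgap', fun j => (hco j).trans ?_,
    fun j => (hco' j).trans ?_, fun A B => ?_⟩
  · have : (n + N : ℝ) ≤ n + 2 * N := by linarith [(Nat.cast_nonneg N : (0 : ℝ) ≤ N)]
    gcongr
  · have : (((n + N : ℕ) : ℝ) + N) ≤ n + 2 * N := by push_cast; linarith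
    gcongr
  have hfac : ∀ (r : ι × Fin 2 → ℝ) (x : ℝ) (i : ι), (∀ b, r (i, b) = x) →
      (1 - Polynomial.C x * Polynomial.X) ^ 2 ∣
        ∏ i, (1 - Polynomial.C (r i) * Polynomial.X) := by
    intro r x i hx
    rw [Fintype.prod_prod_type]
    refine dvd_trans ?_ (Finset.dvd_prod_of_mem _ (Finset.mem_univ i))
    simp [hx]
  have hzero : Polynomial.aeval (shiftEnd τ) h (Polynomial.aeval (shiftEnd (-τ)) h'
      (expSum s A B)) = 0 := by
    have hE : expSum s A B = ∑ i, fun t => (A i + B i * t) * Real.exp (2 * s i * t) := by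
      funext t; simp [expSum]
    rw [hE, map_sum, map_sum]
    refine Finset.sum_eq_zero fun i _ => ?_
    by_cases hi : 0 ≤ s i
    · have hcomm : Commute (Polynomial.aeval (shiftEnd τ) h)
          (Polynomial.aeval (shiftEnd (-τ)) h') := by
        rw [Polynomial.aeval_eq_sum_range, Polynomial.aeval_eq_sum_range]
        exact Commute.sum_left _ _ _ fun i _ => Commute.sum_right _ _ _ fun j _ =>
          (((commute_shiftEnd τ (-τ)).pow_pow i j).smul_left _).smul_right _
      rw [← Module.End.mul_apply, hcomm.eq, Module.End.mul_apply,
        aeval_shiftEnd_exp_eq_zero τ (s i) (A i) (B i) _ rfl h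
          ((hfac r _ i fun b => by simp [hr, hi]).trans hdvd), map_zero]
    · rw [aeval_shiftEnd_exp_eq_zero (-τ) (s i) (A i) (B i) _ rfl h'
          ((hfac r' _ i fun b => by simp [hr', hi]).trans hdvd'), map_zero]
  have := congrFun hzero 0
  rw [aeval_shiftEnd_apply τ h hdeg] at this
  rw [Finset.sum_product]
  refine Eq.trans (Finset.sum_congr rfl fun j _ => ?_) this
  rw [aeval_shiftEnd_apply (-τ) h' (m := n + 2 * N) (fun l hl => hdeg' l (by omega)),
    Finset.mul_sum]
  refine Finset.sum_congr rfl fun l _ => ?_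
  rw [mul_assoc]
  ring_nf

/-- Pointwise decay of Gaussian-weighted exponential sums in terms of their `L²` norm. -/
lemma exists_sq_expSum_zero_le (m : ℕ) : ∃ K : ℝ, 0 < K ∧
    ∀ {ι : Type} [Fintype ι], Fintype.card ι = m → ∀ (s A B : ι → ℝ) (a : ℝ), 0 ≤ a →
      (∀ i, a ≤ |s i|) →
      Integrable (fun t => (Real.exp (-t ^ 2) * expSum s A B t) ^ 2) →
      expSum s A B 0 ^ 2 ≤ K * Real.exp (2 * a - 2 * a ^ 2) *
        ∫ t, (Real.exp (-t ^ 2) * expSum s A B t) ^ 2 := by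
  set N := 2 * m with hN
  set q := 4 * N + 9 with hq
  refine ⟨q.factorial * Real.exp (1 + 2 * N) * (2 ^ (4 * N) * Real.exp (2 * (4 * N + 2) ^ 2)),
    by positivity, ?_⟩
  intro ι _ hm s A B a ha has hintegral
  set u : ℝ → ℝ := fun t => Real.exp (-t ^ 2) * expSum s A B t with hu
  set n := ⌊a⌋₊ + 1 with hn
  have hn0 : 0 < n := Nat.succ_pos _
  have hn1 : (1 : ℝ) ≤ n := by exact_mod_cast hn0
  have han : a ≤ n := by rw [hn]; push_cast; exact (Nat.lt_floor_add_one a).le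
  have hna : (n : ℝ) ≤ a + 1 := by rw [hn]; push_cast; linarith [Nat.floor_le ha]
  have hN0 : (0 : ℝ) ≤ N := Nat.cast_nonneg N
  set M : ℝ := 2 ^ N * (n + 2 * N : ℝ) ^ (N + 1) with hM
  have hM1 : 1 ≤ M := by
    have h1 : (1 : ℝ) ≤ 2 ^ N := one_le_pow₀ (by norm_num)
    have h2 : (1 : ℝ) ≤ (n + 2 * N : ℝ) ^ (N + 1) := one_le_pow₀ (by linarith)
    nlinarith
  set b : ℝ := M ^ 2 * Real.exp (-a ^ 2 + (4 * N + 2) ^ 2) with hb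
  set Λ : Finset (ℕ × ℕ) := (Finset.range (n + N) ×ˢ Finset.range (n + 2 * N)).filter
    (fun p => (p.1 = 0 ∨ n ≤ p.1) ∧ (p.2 = 0 ∨ n + N ≤ p.2) ∧ p ≠ 0) with hΛ
  have hΛcard : (Λ.card : ℝ) ≤ (n + 2 * N : ℝ) ^ 2 := by
    have h1 : Λ.card ≤ (n + N) * (n + 2 * N) := by
      refine (Finset.card_filter_le _ _).trans (by simp)
    calc (Λ.card : ℝ) ≤ ((n + N : ℕ) : ℝ) * ((n + 2 * N : ℕ) : ℝ) := by exact_mod_cast h1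
      _ ≤ _ := by push_cast; nlinarith
  have hpoint : ∀ τ ∈ Set.Icc (1 : ℝ) (1 + 1 / n),
      expSum s A B 0 ^ 2 ≤ b ^ 2 * Λ.card * ∑ p ∈ Λ, u (((p.1 : ℝ) - p.2) * τ) ^ 2 := by
    rintro τ ⟨hτ1, hτ2⟩
    obtain ⟨c, c', h0, h0', hgap, hgap', hc, hc', hrel⟩ := exists_expSum_relation s
      (lt_of_lt_of_le one_pos hτ1) has (n := n) (N := N) (by rw [hN, hm]) hn0
    have hjτ : ∀ j : ℕ, n ≤ j → j < n + 2 * N → a ≤ j * τ ∧ j * τ ≤ a + (4 * N + 2) := by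
      intro j h1 h2
      have h1' : (n : ℝ) ≤ j := by exact_mod_cast h1
      have h2' : (j : ℝ) ≤ n + 2 * N := by exact_mod_cast h2.le
      refine ⟨by nlinarith, ?_⟩
      calc j * τ ≤ (n + 2 * N) * (1 + 1 / n) := by gcongr
        _ = n + 2 * N + 1 + 2 * N / n := by field_simp; ring
        _ ≤ n + 2 * N + 1 + 2 * N := by
            gcongr; exact div_le_self (by positivity) hn1
        _ ≤ _ := by linarith
    have hterm : ∀ p ∈ Λ, |c p.1 * c' p.2 * expSum s A B (((p.1 : ℝ) - p.2) * τ)| ≤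
        b * |u (((p.1 : ℝ) - p.2) * τ)| := by
      rintro ⟨j, l⟩ hp
      simp only [hΛ, Finset.mem_filter, Finset.mem_product, Finset.mem_range, ne_eq,
        Prod.mk_eq_zero] at hp
      obtain ⟨⟨hj, hl⟩, hj', hl', hne⟩ := hp
      simp only
      set x := ((j : ℝ) - l) * τ with hx
      have hE : expSum s A B x = Real.exp (x ^ 2) * u x := by
        rw [hu, ← mul_assoc, ← Real.exp_add]; simp
      have hexp : -(2 * a * τ) * (j + l) + x ^ 2 ≤ -a ^ 2 + (4 * N + 2) ^ 2 := by
        have hj0 : (0 : ℝ) ≤ j := Nat.cast_nonneg j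
        have hl0 : (0 : ℝ) ≤ l := Nat.cast_nonneg l
        rcases hj' with rfl | hj'
        · rcases hl' with rfl | hl'
          · simp at hne
          · obtain ⟨h1, h2⟩ := hjτ l (by omega) hl
            rw [hx]; push_cast
            nlinarith
        · obtain ⟨h1, h2⟩ := hjτ j hj' (by omega)
          rcases hl' with rfl | hl'
          · rw [hx]; push_cast
            nlinarith
          · obtain ⟨h3, h4⟩ := hjτ l (by omega) hl
            have h5 : x ^ 2 ≤ (4 * N + 2) ^ 2 := by
              have h6 : x = j * τ - l * τ := by rw [hx]; ring
              exact sq_le_sq' (by linarith) (by linarith)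
            nlinarith
      rw [hE, abs_mul, abs_mul, abs_mul, abs_of_pos (Real.exp_pos _), ← mul_assoc]
      gcongr
      calc |c j| * |c' l| * Real.exp (x ^ 2)
          ≤ (M * Real.exp (-(2 * a * τ)) ^ j) * (M * Real.exp (-(2 * a * τ)) ^ l) *
            Real.exp (x ^ 2) := by gcongr; exacts [hc j, hc' l]
        _ = M ^ 2 * Real.exp (-(2 * a * τ) * (j + l) + x ^ 2) := by
            rw [Real.exp_add, mul_add, Real.exp_add, mul_comm _ (j : ℝ), mul_comm _ (l : ℝ),
              Real.exp_nat_mul, Real.exp_nat_mul]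
            ring
        _ ≤ b := by rw [hb]; gcongr
    have hsum : expSum s A B 0 = -∑ p ∈ Λ, c p.1 * c' p.2 *
        expSum s A B (((p.1 : ℝ) - p.2) * τ) := by
      have h00 : ((0, 0) : ℕ × ℕ) ∈ Finset.range (n + N) ×ˢ Finset.range (n + 2 * N) := by
        simp; omega
      have h1 := hrel A B
      rw [← Finset.add_sum_erase _ _ h00] at h1
      simp only [h0, h0', Nat.cast_zero, sub_zero, zero_mul, one_mul] at h1
      rw [eq_neg_iff_add_eq_zero]
      refine Eq.trans ?_ h1
      congr 1
      refine Finset.sum_subset ?_ ?_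
      · rintro ⟨j, l⟩ hp
        rw [hΛ, Finset.mem_filter] at hp
        exact Finset.mem_erase.2 ⟨hp.2.2.2, hp.1⟩
      · rintro ⟨j, l⟩ hp hp'
        rw [Finset.mem_erase] at hp
        by_cases hj : j = 0 ∨ n ≤ j
        · by_cases hl : l = 0 ∨ n + N ≤ l
          · exact absurd (by rw [hΛ, Finset.mem_filter]; exact ⟨hp.2, hj, hl, hp.1⟩) hp'
          · simp [hgap' l (by omega) (by omega)]
        · simp [hgap j (by omega) (by omega)]
    calc expSum s A B 0 ^ 2 = |expSum s A B 0| ^ 2 := (sq_abs _).symm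
      _ ≤ (∑ p ∈ Λ, b * |u (((p.1 : ℝ) - p.2) * τ)|) ^ 2 := by
          rw [hsum, abs_neg]
          gcongr
          exact (Finset.abs_sum_le_sum_abs _ _).trans (Finset.sum_le_sum hterm)
      _ ≤ Λ.card * ∑ p ∈ Λ, (b * |u (((p.1 : ℝ) - p.2) * τ)|) ^ 2 := sq_sum_le_card_mul_sum_sq
      _ = _ := by
          simp only [mul_pow, sq_abs]
          rw [← Finset.mul_sum]; ring
  have hne : ∀ p ∈ Λ, (1 : ℝ) ≤ |(p.1 : ℝ) - p.2| := by
    rintro ⟨j, l⟩ hp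
    simp only [hΛ, Finset.mem_filter, Finset.mem_product, Finset.mem_range, ne_eq,
        Prod.mk_eq_zero] at hp
    have h1 : (1 : ℤ) ≤ |(j : ℤ) - l| := Int.one_le_abs (by omega)
    exact_mod_cast h1
  have hintp : ∀ p ∈ Λ, Integrable (fun τ : ℝ => u (((p.1 : ℝ) - p.2) * τ) ^ 2) := fun p hp =>
    hintegral.comp_mul_left' (fun h => by have := hne p hp; rw [h] at this; norm_num at this)
  set Q := ∫ t, u t ^ 2 with hQ
  have hQ0 : 0 ≤ Q := integral_nonneg fun t => sq_nonneg _
  have havg : 1 / n * expSum s A B 0 ^ 2 ≤ b ^ 2 * Λ.card * (Λ.card * Q) := by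
    calc 1 / n * expSum s A B 0 ^ 2
        = ∫ τ in Set.Icc (1 : ℝ) (1 + 1 / n), expSum s A B 0 ^ 2 := by
          simp
      _ ≤ ∫ τ in Set.Icc (1 : ℝ) (1 + 1 / n),
            b ^ 2 * Λ.card * ∑ p ∈ Λ, u (((p.1 : ℝ) - p.2) * τ) ^ 2 := by
          refine setIntegral_mono_on (by simp) ?_ measurableSet_Icc hpoint
          exact ((integrable_finsetSum _ hintp).const_mul _).integrableOn
      _ ≤ ∫ τ, b ^ 2 * Λ.card * ∑ p ∈ Λ, u (((p.1 : ℝ) - p.2) * τ) ^ 2 := by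
          refine setIntegral_le_integral ((integrable_finsetSum _ hintp).const_mul _) ?_
          exact Filter.Eventually.of_forall fun τ => by
            show 0 ≤ _
            positivity
      _ = b ^ 2 * Λ.card * ∑ p ∈ Λ, ∫ τ, u (((p.1 : ℝ) - p.2) * τ) ^ 2 := by
          rw [integral_const_mul, integral_finsetSum _ hintp]
      _ ≤ b ^ 2 * Λ.card * ∑ p ∈ Λ, Q := by
          gcongr with p hp
          rw [Measure.integral_comp_mul_left (fun t => u t ^ 2), smul_eq_mul, abs_inv]
          exact mul_le_of_le_one_left hQ0 (inv_le_one_of_one_le₀ (hne p hp))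
      _ = _ := by rw [Finset.sum_const, nsmul_eq_mul]
  have hx0 : (0 : ℝ) ≤ n + 2 * N := by positivity
  calc expSum s A B 0 ^ 2 = n * (1 / n * expSum s A B 0 ^ 2) := by field_simp
    _ ≤ (n + 2 * N) * (b ^ 2 * (n + 2 * N : ℝ) ^ 2 * ((n + 2 * N : ℝ) ^ 2 * Q)) := by
        have h3 : (n : ℝ) ≤ n + 2 * N := by linarith
        refine mul_le_mul h3 (havg.trans ?_) (by positivity) hx0
        gcongr
    _ = (n + 2 * N : ℝ) ^ q * (2 ^ (4 * N) * Real.exp (2 * (4 * N + 2) ^ 2)) *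
          Real.exp (-(2 * a ^ 2)) * Q := by
        have e1 : Real.exp (-a ^ 2 + (4 * N + 2) ^ 2) ^ 2 =
            Real.exp (2 * (4 * N + 2) ^ 2) * Real.exp (-(2 * a ^ 2)) := by
          rw [← Real.exp_nat_mul, ← Real.exp_add]; push_cast; ring_nf
        rw [hb, mul_pow, e1, hM, hq]
        ring
    _ ≤ (q.factorial * (Real.exp (1 + 2 * N) * Real.exp (2 * a))) *
          (2 ^ (4 * N) * Real.exp (2 * (4 * N + 2) ^ 2)) * Real.exp (-(2 * a ^ 2)) * Q := by
        gcongr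
        have h1 := Real.pow_div_factorial_le_exp (n + 2 * N : ℝ) hx0 q
        rw [div_le_iff₀' (by positivity)] at h1
        refine h1.trans ?_
        rw [← Real.exp_add]
        exact mul_le_mul_of_nonneg_left (Real.exp_le_exp.2 (by linarith)) (by positivity)
    _ = _ := by
        have e2 : Real.exp (2 * a - 2 * a ^ 2) = Real.exp (2 * a) * Real.exp (-(2 * a ^ 2)) := by
          rw [← Real.exp_add, sub_eq_add_neg]
        rw [e2]; ring

open Polynomial in
/-- Exponentials with distinct rates and affine coefficients are linearly independent. -/
lemma eq_zero_of_expSum_eq_zero {ι : Type*} [Fintype ι] {s A B : ι → ℝ}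
    (hs : Function.Injective s) (h : ∀ t, expSum s A B t = 0) (i : ι) : A i = 0 ∧ B i = 0 := by
  classical
  set r : ι → ℝ := fun j => Real.exp (-(2 * s j * 1)) with hr
  set f : ι → ℝ → ℝ := fun j t => (A j + B j * t) * Real.exp (2 * s j * t) with hf
  have hrinj : ∀ j, j ≠ i → r j - r i ≠ 0 := by
    intro j hj h0
    have := Real.exp_injective (sub_eq_zero.1 h0)
    exact hj (hs (by linarith))
  set p : ℝ[X] := ∏ j ∈ Finset.univ.erase i, (1 - C (r j) * X) ^ 2 with hp
  have hco : IsCoprime p ((1 - C (r i) * X) ^ 2) := by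
    refine IsCoprime.prod_left fun j hj => IsCoprime.pow ?_
    have hne := hrinj j (Finset.ne_of_mem_erase hj)
    refine ⟨C (-r i / (r j - r i)), C (r j / (r j - r i)), ?_⟩
    have e1 : C (-r i / (r j - r i)) + C (r j / (r j - r i)) = (1 : ℝ[X]) := by
      rw [← C_add, ← C_1]; congr 1; field_simp; ring
    have e2 : C (-r i / (r j - r i)) * C (r j) + C (r j / (r j - r i)) * C (r i) = (0 : ℝ[X]) := by
      rw [← C_mul, ← C_mul, ← C_add, ← C_0]; congr 1; field_simp; ring
    linear_combination e1 - X * e2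
  have hpf : aeval (shiftEnd 1) p (f i) = 0 := by
    have hsum : ∑ j, f j = 0 := by
      funext t; simpa [expSum, hf] using h t
    have h1 := congrArg (aeval (shiftEnd 1) p) hsum
    rw [map_sum, map_zero, ← Finset.add_sum_erase _ _ (Finset.mem_univ i),
      Finset.sum_eq_zero, add_zero] at h1
    · exact h1
    · intro j hj
      exact aeval_shiftEnd_exp_eq_zero 1 (s j) (A j) (B j) _ rfl p (Finset.dvd_prod_of_mem _ hj)
  obtain ⟨a, b, hab⟩ := hco
  have hfi : f i = 0 := by
    have h1 := congrArg (fun q => aeval (shiftEnd 1) q (f i)) hab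
    simp only [map_add, map_mul, map_one, LinearMap.add_apply, Module.End.mul_apply, hpf, map_zero,
      zero_add, Module.End.one_apply] at h1
    rw [← h1, ← Module.End.mul_apply, ← map_mul]
    exact aeval_shiftEnd_exp_eq_zero 1 (s i) (A i) (B i) _ rfl _ (dvd_mul_left _ _)
  have h0 := congrFun hfi 0
  have h1 := congrFun hfi 1
  simp only [hf, mul_zero, add_zero, Real.exp_zero, mul_one, Pi.zero_apply, mul_eq_zero,
    (Real.exp_pos _).ne', or_false] at h0 h1
  exact ⟨h0, by linarith⟩

lemma integral_quadratic_mul_gaussian (α β γ : ℝ) :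
    Integrable (fun z : ℝ => (α + β * z + γ * z ^ 2) * Real.exp (-2 * z ^ 2)) ∧
      ∫ z : ℝ, (α + β * z + γ * z ^ 2) * Real.exp (-2 * z ^ 2) =
        Real.sqrt (Real.pi / 2) * (α + γ / 4) := by
  have i0 : Integrable (fun z : ℝ => Real.exp (-2 * z ^ 2)) :=
    integrable_exp_neg_mul_sq two_pos
  have i1 : Integrable (fun z : ℝ => z * Real.exp (-2 * z ^ 2)) :=
    integrable_mul_exp_neg_mul_sq two_pos
  have i2 : Integrable (fun z : ℝ => z ^ 2 * Real.exp (-2 * z ^ 2)) := by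
    simpa using integrable_rpow_mul_exp_neg_mul_sq (b := 2) two_pos (s := 2) (by norm_num)
  have hpdf : ∀ x, gaussianPDFReal 0 (1 / 4) x =
      (Real.sqrt (Real.pi / 2))⁻¹ * Real.exp (-2 * x ^ 2) := by
    intro x
    rw [gaussianPDFReal]
    push_cast
    congr 3 <;> ring
  have hne : Real.sqrt (Real.pi / 2) ≠ 0 := by positivity
  have h0 : ∫ z : ℝ, Real.exp (-2 * z ^ 2) = Real.sqrt (Real.pi / 2) := integral_gaussian 2
  have h1 : ∫ z : ℝ, z * Real.exp (-2 * z ^ 2) = 0 := by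
    have := integral_id_gaussianReal (μ := 0) (v := 1 / 4)
    rw [integral_gaussianReal_eq_integral_smul (by norm_num)] at this
    simp only [hpdf, smul_eq_mul, mul_assoc] at this
    rw [integral_const_mul, mul_eq_zero] at this
    rcases this with h | h
    · exact absurd h (inv_ne_zero hne)
    · simpa only [mul_comm] using h
  have h2 : ∫ z : ℝ, z ^ 2 * Real.exp (-2 * z ^ 2) = Real.sqrt (Real.pi / 2) / 4 := by
    have := variance_fun_id_gaussianReal (μ := 0) (v := 1 / 4)
    rw [variance_eq_integral (by fun_prop), integral_id_gaussianReal,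
      integral_gaussianReal_eq_integral_smul (by norm_num)] at this
    simp only [hpdf, smul_eq_mul, mul_assoc, sub_zero] at this
    rw [integral_const_mul] at this
    push_cast at this
    have h3 : ∫ z : ℝ, z ^ 2 * Real.exp (-2 * z ^ 2) = ∫ z : ℝ, Real.exp (-2 * z ^ 2) * z ^ 2 := by
      simp only [mul_comm]
    rw [h3]
    field_simp at this ⊢
    linarith
  have e : (fun z : ℝ => (α + β * z + γ * z ^ 2) * Real.exp (-2 * z ^ 2)) = fun z =>
      (α * Real.exp (-2 * z ^ 2) + β * (z * Real.exp (-2 * z ^ 2))) +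
        γ * (z ^ 2 * Real.exp (-2 * z ^ 2)) := by
    funext z; ring
  have i01 : Integrable (fun z : ℝ =>
      α * Real.exp (-2 * z ^ 2) + β * (z * Real.exp (-2 * z ^ 2))) :=
    (i0.const_mul _).add (i1.const_mul _)
  rw [e]
  refine ⟨i01.add (i2.const_mul _), ?_⟩
  rw [integral_add i01 (i2.const_mul _),
    integral_add (i0.const_mul _) (i1.const_mul _), integral_const_mul, integral_const_mul,
    integral_const_mul, h0, h1, h2]
  ring

/-- `L²` representatives of the evaluation (`a = 0`) and derivative (`a = 1`) functionals at `s`. -/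
def weylJet (s : ℝ) (a : Fin 2) (y : ℝ) : ℝ :=
  Real.exp (-y ^ 2) * ((if a = 0 then 1 else 2 * y - s) * Real.exp (2 * y * s - s ^ 2 / 2))

lemma integral_weylJet_mul (s t : ℝ) (a b : Fin 2) :
    Integrable (fun y => weylJet s a y * weylJet t b y) ∧
      ∫ y, weylJet s a y * weylJet t b y = Real.sqrt (Real.pi / 2) * weylCov s t a b := by
  have key : ∃ α β γ : ℝ, α + γ / 4 = weylCov s t a b ∧ ∀ y, weylJet s a y * weylJet t b y =
      (α + β * (y - (s + t) / 2) + γ * (y - (s + t) / 2) ^ 2) *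
        Real.exp (-2 * (y - (s + t) / 2) ^ 2) := by
    have hexp : ∀ y : ℝ, Real.exp (-y ^ 2) * Real.exp (2 * y * s - s ^ 2 / 2) *
        (Real.exp (-y ^ 2) * Real.exp (2 * y * t - t ^ 2 / 2)) =
        Real.exp (s * t) * Real.exp (-2 * (y - (s + t) / 2) ^ 2) := by
      intro y
      simp only [← Real.exp_add]
      ring_nf
    have hprod : ∀ y P Q : ℝ, (Real.exp (-y ^ 2) * (P * Real.exp (2 * y * s - s ^ 2 / 2))) *
        (Real.exp (-y ^ 2) * (Q * Real.exp (2 * y * t - t ^ 2 / 2))) =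
        P * Q * (Real.exp (s * t) * Real.exp (-2 * (y - (s + t) / 2) ^ 2)) := by
      intro y P Q
      rw [← hexp]; ring
    fin_cases a <;> fin_cases b <;> simp only [weylJet, weylCov, hprod]
    · exact ⟨Real.exp (s * t), 0, 0, by simp, fun y => by simp⟩
    · exact ⟨s * Real.exp (s * t), 2 * Real.exp (s * t), 0, by simp, fun y => by simp; ring⟩
    · exact ⟨t * Real.exp (s * t), 2 * Real.exp (s * t), 0, by simp, fun y => by simp; ring⟩
    · exact ⟨s * t * Real.exp (s * t), 2 * (s + t) * Real.exp (s * t), 4 * Real.exp (s * t),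
        by simp; ring, fun y => by simp; ring⟩
  obtain ⟨α, β, γ, h1, h2⟩ := key
  obtain ⟨hi, hv⟩ := integral_quadratic_mul_gaussian α β γ
  simp only [h2]
  refine ⟨hi.comp_sub_right ((s + t) / 2), ?_⟩
  rw [integral_sub_right_eq_self
    (fun z : ℝ => (α + β * z + γ * z ^ 2) * Real.exp (-2 * z ^ 2)), hv, h1]

/-- The `L²` representative of a linear combination of 1-jets at the points `x i`. -/
def weylFun {ι : Type*} [Fintype ι] (x : ι → ℝ) (z : ι × Fin 2 → ℝ) (y : ℝ) : ℝ :=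
  ∑ p, z p * weylJet (x p.1) p.2 y

/-- The covariance matrix of the 1-jets at the points `x i`, for an arbitrary index type. -/
def weylGram {ι : Type*} (x : ι → ℝ) : Matrix (ι × Fin 2) (ι × Fin 2) ℝ :=
  fun p q => weylCov (x p.1) (x q.1) p.2 q.2

lemma weylFun_mul_eq {ι κ : Type*} [Fintype ι] [Fintype κ] (x : ι → ℝ) (x' : κ → ℝ)
    (z : ι × Fin 2 → ℝ) (w : κ × Fin 2 → ℝ) :
    (fun y => weylFun x z y * weylFun x' w y) = fun y => ∑ p, ∑ q,
      z p * w q * (weylJet (x p.1) p.2 y * weylJet (x' q.1) q.2 y) := by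
  funext y
  rw [weylFun, weylFun, Finset.sum_mul_sum]
  exact Finset.sum_congr rfl fun p _ => Finset.sum_congr rfl fun q _ => by ring

lemma integrable_weylFun_mul {ι κ : Type*} [Fintype ι] [Fintype κ] (x : ι → ℝ) (x' : κ → ℝ)
    (z : ι × Fin 2 → ℝ) (w : κ × Fin 2 → ℝ) :
    Integrable (fun y => weylFun x z y * weylFun x' w y) := by
  rw [weylFun_mul_eq]
  exact integrable_finsetSum _ fun p _ => integrable_finsetSum _ fun q _ =>
    (integral_weylJet_mul _ _ _ _).1.const_mul _

lemma integral_weylFun_mul {ι κ : Type*} [Fintype ι] [Fintype κ] (x : ι → ℝ) (x' : κ → ℝ)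
    (z : ι × Fin 2 → ℝ) (w : κ × Fin 2 → ℝ) :
    ∫ y, weylFun x z y * weylFun x' w y = Real.sqrt (Real.pi / 2) *
      ∑ p, ∑ q, z p * w q * weylCov (x p.1) (x' q.1) p.2 q.2 := by
  rw [weylFun_mul_eq, integral_finsetSum _ fun p _ => integrable_finsetSum _ fun q _ =>
    (integral_weylJet_mul _ _ _ _).1.const_mul _, Finset.mul_sum]
  refine Finset.sum_congr rfl fun p _ => ?_
  rw [integral_finsetSum _ fun q _ => (integral_weylJet_mul _ _ _ _).1.const_mul _, Finset.mul_sum]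
  refine Finset.sum_congr rfl fun q _ => ?_
  rw [integral_const_mul, (integral_weylJet_mul _ _ _ _).2]
  ring

lemma weylFun_add_eq {ι : Type*} [Fintype ι] (x : ι → ℝ) (z : ι × Fin 2 → ℝ) (y t : ℝ) :
    weylFun x z (y + t) = Real.exp (-t ^ 2) * expSum (fun i => x i - y)
      (fun i => (z (i, 0) + z (i, 1) * (2 * y - x i)) *
        Real.exp (-y ^ 2 + 2 * y * x i - x i ^ 2 / 2))
      (fun i => 2 * z (i, 1) * Real.exp (-y ^ 2 + 2 * y * x i - x i ^ 2 / 2)) t := by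
  rw [weylFun, expSum, Fintype.sum_prod_type, Finset.mul_sum]
  refine Finset.sum_congr rfl fun i _ => ?_
  have e : Real.exp (-(y + t) ^ 2) * Real.exp (2 * (y + t) * x i - x i ^ 2 / 2) =
      Real.exp (-t ^ 2) * (Real.exp (-y ^ 2 + 2 * y * x i - x i ^ 2 / 2) *
        Real.exp (2 * (x i - y) * t)) := by
    simp only [← Real.exp_add]; ring_nf
  simp only [Fin.sum_univ_two, weylJet, Fin.isValue, if_true, one_ne_zero, if_false, one_mul]
  linear_combination (z (i, 0) + z (i, 1) * (2 * (y + t) - x i)) * e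

/-- Decay of `weylFun x z` away from the points `x i`, uniform in the configuration. -/
lemma exists_sq_weylFun_le (m : ℕ) : ∃ K : ℝ, 0 < K ∧
    ∀ {ι : Type} [Fintype ι], Fintype.card ι = m → ∀ (x : ι → ℝ) (z : ι × Fin 2 → ℝ) (y a : ℝ),
      0 ≤ a → (∀ i, a ≤ |x i - y|) →
      weylFun x z y ^ 2 ≤ K * Real.exp (2 * a - 2 * a ^ 2) * ∫ t, weylFun x z t ^ 2 := by
  obtain ⟨K, hK, h⟩ := exists_sq_expSum_zero_le m
  refine ⟨K, hK, fun hm x z y a ha hax => ?_⟩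
  have h0 := weylFun_add_eq x z y 0
  have e1 : ∫ t, weylFun x z t ^ 2 = ∫ t, weylFun x z (y + t) ^ 2 :=
    (integral_add_left_eq_self (fun t => weylFun x z t ^ 2) y).symm
  have i1 : Integrable (fun t => weylFun x z (y + t) ^ 2) := by
    have := integrable_weylFun_mul x x z z
    simp only [← pow_two] at this
    exact this.comp_add_left y
  simp only [add_zero, ne_eq, OfNat.ofNat_ne_zero, not_false_eq_true, zero_pow, neg_zero,
    Real.exp_zero, one_mul] at h0
  rw [h0, e1]
  simp only [weylFun_add_eq] at i1 ⊢
  exact h hm _ _ _ a ha hax i1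

lemma abs_le_of_sq_le_exp (K P u p : ℝ) (hK : 0 ≤ K) (hP : 0 ≤ P)
    (hu : u ^ 2 ≤ K * Real.exp (2 * p - 2 * p ^ 2) * P) :
    |u| ≤ Real.sqrt K * Real.exp (p - p ^ 2) * Real.sqrt P := by
  refine abs_le_of_sq_le_sq (hu.trans_eq ?_) (by positivity)
  rw [mul_pow, mul_pow, Real.sq_sqrt hK, Real.sq_sqrt hP, ← Real.exp_nat_mul]
  push_cast; ring_nf

lemma abs_sub_sq_add_le {s t d : ℝ} (hd : 1 ≤ d) (hst : d ≤ |s - t|) (y : ℝ) :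
    |s - y| - |s - y| ^ 2 + (|t - y| - |t - y| ^ 2) ≤
      3 / 2 + (-(d - 1) ^ 2 / 2 + -1 * (y - (s + t) / 2) ^ 2) := by
  have h1 : |s - y| ^ 2 + |t - y| ^ 2 = 2 * (y - (s + t) / 2) ^ 2 + |s - t| ^ 2 / 2 := by
    simp only [sq_abs]; ring
  have h2 : |s - y| + |t - y| ≤ |s - t| + 2 * |y - (s + t) / 2| := by
    have a1 := le_abs_self (s - t)
    have a2 := neg_abs_le (s - t)
    have a3 := le_abs_self (y - (s + t) / 2)
    have a4 := neg_abs_le (y - (s + t) / 2)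
    rcases abs_cases (s - y) with ⟨h5, _⟩ | ⟨h5, _⟩ <;>
    rcases abs_cases (t - y) with ⟨h6, _⟩ | ⟨h6, _⟩ <;> rw [h5, h6] <;>
    linarith [abs_nonneg (s - t), abs_nonneg (y - (s + t) / 2)]
  have h3 : 2 * |y - (s + t) / 2| ≤ 1 + (y - (s + t) / 2) ^ 2 := by
    nlinarith [sq_nonneg (|y - (s + t) / 2| - 1), sq_abs (y - (s + t) / 2)]
  have h4 : 0 ≤ (|s - t| - d) * (|s - t| + d - 2) :=
    mul_nonneg (by linarith) (by linarith)
  linarith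

/-- Configurations at distance `d` span almost orthogonal subspaces. -/
lemma exists_abs_integral_weylFun_mul_le (m m' : ℕ) : ∃ K : ℝ, 0 < K ∧
    ∀ {ι κ : Type} [Fintype ι] [Fintype κ] [Nonempty ι] [Nonempty κ], Fintype.card ι = m →
      Fintype.card κ = m' → ∀ (x : ι → ℝ) (x' : κ → ℝ) (d : ℝ), 1 ≤ d →
      (∀ i j, d ≤ |x i - x' j|) → ∀ (z : ι × Fin 2 → ℝ) (w : κ × Fin 2 → ℝ),
      2 * |∫ y, weylFun x z y * weylFun x' w y| ≤ K * Real.exp (-(d - 1) ^ 2 / 2) *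
        ((∫ y, weylFun x z y ^ 2) + ∫ y, weylFun x' w y ^ 2) := by
  obtain ⟨K, hK, h⟩ := exists_sq_weylFun_le m
  obtain ⟨K', hK', h'⟩ := exists_sq_weylFun_le m'
  refine ⟨Real.sqrt K * Real.sqrt K' * (Real.exp (3 / 2) * (m * (m' * Real.sqrt (Real.pi / 1))) + 1),
    by positivity, fun {ι κ} _ _ _ _ hm hm' x x' d hd hdist z w => ?_⟩
  set P := ∫ y, weylFun x z y ^ 2 with hP
  set Q := ∫ y, weylFun x' w y ^ 2 with hQ
  have hP0 : 0 ≤ P := integral_nonneg fun t => sq_nonneg _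
  have hQ0 : 0 ≤ Q := integral_nonneg fun t => sq_nonneg _
  set δ := Real.exp (-(d - 1) ^ 2 / 2) with hδ
  set g : ℝ → ℝ := fun y => ∑ i, ∑ j, Real.exp (-1 * (y - (x i + x' j) / 2) ^ 2) with hg
  have higauss : ∀ i j, Integrable fun y => Real.exp (-1 * (y - (x i + x' j) / 2) ^ 2) := fun i j =>
    (integrable_exp_neg_mul_sq one_pos).comp_sub_right ((x i + x' j) / 2)
  have hgi : Integrable g := integrable_finsetSum _ fun i _ => integrable_finsetSum _ fun j _ =>
    higauss i j
  have hgv : ∫ y, g y = m * (m' * Real.sqrt (Real.pi / 1)) := by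
    have h1 : ∀ i j, ∫ y, Real.exp (-1 * (y - (x i + x' j) / 2) ^ 2) = Real.sqrt (Real.pi / 1) := by
      intro i j
      rw [integral_sub_right_eq_self (fun y : ℝ => Real.exp (-1 * y ^ 2)), integral_gaussian]
    rw [hg, integral_finsetSum _ fun i _ => integrable_finsetSum _ fun j _ => higauss i j]
    simp_rw [integral_finsetSum Finset.univ fun j _ => higauss _ j, h1]
    simp [hm, hm']
  have hpoint : ∀ y, ‖weylFun x z y * weylFun x' w y‖ ≤
      Real.sqrt K * Real.sqrt K' * (Real.sqrt P * Real.sqrt Q) * (Real.exp (3 / 2) * δ) * g y := by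
    intro y
    obtain ⟨i, hi⟩ := Finite.exists_min fun i => |x i - y|
    obtain ⟨j, hj⟩ := Finite.exists_min fun j => |x' j - y|
    have h1 := h hm x z y _ (abs_nonneg _) hi
    have h2 := h' hm' x' w y _ (abs_nonneg _) hj
    set p := |x i - y| with hp
    set q := |x' j - y| with hq
    have h3 := abs_le_of_sq_le_exp K P _ p hK.le hP0 h1
    have h4 := abs_le_of_sq_le_exp K' Q _ q hK'.le hQ0 h2
    have hexp : p - p ^ 2 + (q - q ^ 2) ≤
        3 / 2 + (-(d - 1) ^ 2 / 2 + -1 * (y - (x i + x' j) / 2) ^ 2) :=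
      abs_sub_sq_add_le hd (hdist i j) y
    have hle : Real.exp (-1 * (y - (x i + x' j) / 2) ^ 2) ≤ g y := by
      refine le_trans ?_ (Finset.single_le_sum (f := fun i => ∑ j,
        Real.exp (-1 * (y - (x i + x' j) / 2) ^ 2)) (fun i _ => by positivity) (Finset.mem_univ i))
      exact Finset.single_le_sum (f := fun j => Real.exp (-1 * (y - (x i + x' j) / 2) ^ 2))
        (fun j _ => by positivity) (Finset.mem_univ j)
    rw [Real.norm_eq_abs, abs_mul]
    calc |weylFun x z y| * |weylFun x' w y|
        ≤ (Real.sqrt K * Real.exp (p - p ^ 2) * Real.sqrt P) *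
          (Real.sqrt K' * Real.exp (q - q ^ 2) * Real.sqrt Q) := by gcongr
      _ = Real.sqrt K * Real.sqrt K' * (Real.sqrt P * Real.sqrt Q) *
          Real.exp (p - p ^ 2 + (q - q ^ 2)) := by rw [Real.exp_add]; ring
      _ ≤ Real.sqrt K * Real.sqrt K' * (Real.sqrt P * Real.sqrt Q) *
          Real.exp (3 / 2 + (-(d - 1) ^ 2 / 2 + -1 * (y - (x i + x' j) / 2) ^ 2)) := by gcongr
      _ = Real.sqrt K * Real.sqrt K' * (Real.sqrt P * Real.sqrt Q) * (Real.exp (3 / 2) * δ) *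
          Real.exp (-1 * (y - (x i + x' j) / 2) ^ 2) := by
          rw [Real.exp_add, Real.exp_add]; ring
      _ ≤ _ := by gcongr
  have hintegral := norm_integral_le_of_norm_le (hgi.const_mul _) (Filter.Eventually.of_forall hpoint)
  rw [integral_const_mul, hgv, Real.norm_eq_abs] at hintegral
  have hPQ : 2 * (Real.sqrt P * Real.sqrt Q) ≤ P + Q := by
    nlinarith [sq_nonneg (Real.sqrt P - Real.sqrt Q), Real.sq_sqrt hP0, Real.sq_sqrt hQ0]
  calc 2 * |∫ y, weylFun x z y * weylFun x' w y|
      ≤ 2 * (Real.sqrt K * Real.sqrt K' * (Real.sqrt P * Real.sqrt Q) * (Real.exp (3 / 2) * δ) *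
        (m * (m' * Real.sqrt (Real.pi / 1)))) := by gcongr
    _ = Real.sqrt K * Real.sqrt K' * (Real.exp (3 / 2) * (m * (m' * Real.sqrt (Real.pi / 1)))) * δ *
        (2 * (Real.sqrt P * Real.sqrt Q)) := by ring
    _ ≤ Real.sqrt K * Real.sqrt K' * (Real.exp (3 / 2) * (m * (m' * Real.sqrt (Real.pi / 1))) + 1) *
        δ * (P + Q) := by
        gcongr
        linarith

lemma integral_weylFun_sq {ι : Type*} [Fintype ι] (x : ι → ℝ) (z : ι × Fin 2 → ℝ) :
    ∫ y, weylFun x z y ^ 2 = Real.sqrt (Real.pi / 2) * (z ⬝ᵥ (weylGram x).mulVec z) := by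
  simp only [pow_two]
  rw [integral_weylFun_mul]
  simp only [dotProduct, Matrix.mulVec, weylGram, Finset.mul_sum]
  refine Finset.sum_congr rfl fun p _ => Finset.sum_congr rfl fun q _ => by ring

lemma weylCov_symm (s t : ℝ) (a b : Fin 2) : weylCov s t a b = weylCov t s b a := by
  have h1 := (integral_weylJet_mul s t a b).2
  have h2 := (integral_weylJet_mul t s b a).2
  simp only [mul_comm (weylJet t b _)] at h2
  exact mul_left_cancel₀ (by positivity) (h1.symm.trans h2)

lemma isHermitian_weylGram {ι : Type*} (x : ι → ℝ) : (weylGram x).IsHermitian := by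
  ext p q
  exact weylCov_symm _ _ _ _

lemma posDef_weylGram {ι : Type} [Fintype ι] {x : ι → ℝ} (hx : Function.Injective x) :
    (weylGram x).PosDef := by
  refine Matrix.PosDef.of_dotProduct_mulVec_pos (isHermitian_weylGram x) fun z hz => ?_
  rw [star_trivial]
  have h0 : 0 ≤ ∫ y, weylFun x z y ^ 2 := integral_nonneg fun t => sq_nonneg _
  have hc : 0 < Real.sqrt (Real.pi / 2) := by positivity
  rw [integral_weylFun_sq] at h0
  refine lt_of_le_of_ne (nonneg_of_mul_nonneg_right h0 hc) fun h => hz ?_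
  obtain ⟨K, -, hK⟩ := exists_sq_weylFun_le (Fintype.card ι)
  have hzero : ∀ y, weylFun x z y = 0 := by
    intro y
    have := hK rfl x z y 0 le_rfl fun i => abs_nonneg _
    rw [integral_weylFun_sq, ← h, mul_zero, mul_zero, mul_zero] at this
    exact pow_eq_zero_iff two_ne_zero |>.1 (le_antisymm this (sq_nonneg _))
  have hexp : ∀ t, expSum (fun i => x i - 0)
      (fun i => (z (i, 0) + z (i, 1) * (2 * 0 - x i)) *
        Real.exp (-0 ^ 2 + 2 * 0 * x i - x i ^ 2 / 2))
      (fun i => 2 * z (i, 1) * Real.exp (-0 ^ 2 + 2 * 0 * x i - x i ^ 2 / 2)) t = 0 := by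
    intro t
    have := weylFun_add_eq x z 0 t
    rw [hzero] at this
    simpa only [zero_eq_mul, (Real.exp_pos _).ne', false_or] using this
  have hz' := eq_zero_of_expSum_eq_zero (fun i j hij => hx (by simpa using hij)) hexp
  funext ⟨i, b⟩
  obtain ⟨h1, h2⟩ := hz' i
  simp only [mul_eq_zero, (Real.exp_pos _).ne', or_false, two_ne_zero, false_or] at h1 h2
  rw [h2, zero_mul, add_zero] at h1
  fin_cases b
  · exact h1
  · exact h2

/-- The vector `(0, η i)_i` of 1-jets with vanishing values and derivatives `η`. -/
def jetVec {ι : Type*} (η : ι → ℝ) : ι × Fin 2 → ℝ :=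
  fun p => if p.2 = 1 then η p.1 else 0

/-- The quadratic form of `A⁻¹` at the jet with vanishing values and derivatives `η`. -/
def jetForm {ι : Type*} [Fintype ι] [DecidableEq ι] (A : Matrix (ι × Fin 2) (ι × Fin 2) ℝ)
    (η : ι → ℝ) : ℝ :=
  A⁻¹.mulVec (jetVec η) ⬝ᵥ jetVec η

/-- The Kac–Rice density (without the factor `(2π)⁻ⁿ`) attached to a covariance matrix of jets. -/
def kacRice {ι : Type*} [Fintype ι] [DecidableEq ι] (A : Matrix (ι × Fin 2) (ι × Fin 2) ℝ) : ℝ :=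
  (Real.sqrt |A.det|)⁻¹ * ∫ η : ι → ℝ, (∏ i, |η i|) * Real.exp (-(1 / 2) * jetForm A η)

lemma weylRho_eq_kacRice (k : ℕ) (x : Fin k → ℝ) :
    weylRho k x = ((2 * Real.pi) ^ k)⁻¹ * kacRice (weylGram x) := by
  rw [kacRice, ← mul_assoc]
  rfl

lemma kacRice_submatrix {ι κ : Type*} [Fintype ι] [DecidableEq ι] [Fintype κ] [DecidableEq κ]
    (e : ι ≃ κ) (A : Matrix (κ × Fin 2) (κ × Fin 2) ℝ) :
    kacRice (A.submatrix (e.prodCongr (Equiv.refl _)) (e.prodCongr (Equiv.refl _))) =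
      kacRice A := by
  rw [kacRice, kacRice, Matrix.det_submatrix_equiv_self]
  congr 1
  rw [← (volume_measurePreserving_piCongrLeft (fun _ : κ => ℝ) e).integral_comp']
  congr 1
  funext η
  have h1 : ∀ i, MeasurableEquiv.piCongrLeft (fun _ : κ => ℝ) e η (e i) = η i := fun i => by
    rw [MeasurableEquiv.coe_piCongrLeft]
    exact Equiv.piCongrLeft_apply_apply (fun _ : κ => ℝ) e η i
  set ζ := MeasurableEquiv.piCongrLeft (fun _ : κ => ℝ) e η
  have h2 : jetVec η ∘ (e.prodCongr (Equiv.refl (Fin 2))).symm = jetVec ζ := by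
    funext ⟨j, b⟩
    obtain ⟨i, rfl⟩ := e.surjective j
    simp [jetVec, h1]
  have h3 : jetVec η = jetVec ζ ∘ e.prodCongr (Equiv.refl (Fin 2)) := by
    rw [← h2]
    exact funext fun p => congrArg (jetVec η) (Equiv.symm_apply_apply _ p).symm
  congr 1
  · rw [← e.prod_comp]
    simp only [h1]
  · rw [jetForm, jetForm, Matrix.inv_submatrix_equiv, Matrix.submatrix_mulVec_equiv, h2, h3,
      comp_equiv_dotProduct_comp_equiv]

lemma kacRice_fromBlocks {ι κ : Type*} [Fintype ι] [DecidableEq ι] [Fintype κ] [DecidableEq κ]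
    {A : Matrix (ι × Fin 2) (ι × Fin 2) ℝ} {B : Matrix (κ × Fin 2) (κ × Fin 2) ℝ}
    (hA : IsUnit A) (hB : IsUnit B) :
    kacRice ((Matrix.fromBlocks A 0 0 B).submatrix (Equiv.sumProdDistrib ι κ (Fin 2))
      (Equiv.sumProdDistrib ι κ (Fin 2))) = kacRice A * kacRice B := by
  rw [kacRice, kacRice, kacRice, Matrix.det_submatrix_equiv_self, Matrix.det_fromBlocks_zero₂₁,
    abs_mul, Real.sqrt_mul (abs_nonneg _), mul_inv, mul_mul_mul_comm]
  congr 1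
  rw [← integral_prod_mul, ← Measure.volume_eq_prod,
    ← (volume_measurePreserving_sumPiEquivProdPi (fun _ : ι ⊕ κ => ℝ)).integral_comp']
  congr 1
  funext η
  rw [mul_mul_mul_comm, ← Real.exp_add, ← mul_add, Fintype.prod_sum_type]
  congr 3
  rw [jetForm, jetForm, jetForm, Matrix.inv_submatrix_equiv,
    Matrix.inv_fromBlocks_zero₂₁_of_isUnit_iff _ _ _ (by simp [hA, hB]),
    Matrix.submatrix_mulVec_equiv]
  set u : ι → ℝ := fun i => η (Sum.inl i)
  set v : κ → ℝ := fun i => η (Sum.inr i)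
  have h2 : jetVec η ∘ (Equiv.sumProdDistrib ι κ (Fin 2)).symm =
      Sum.elim (jetVec u) (jetVec v) := by
    funext p
    rcases p with p | p <;> rfl
  have h3 : jetVec η = Sum.elim (jetVec u) (jetVec v) ∘ Equiv.sumProdDistrib ι κ (Fin 2) := by
    rw [← h2]; funext p; simp
  rw [h2, h3, comp_equiv_dotProduct_comp_equiv, Matrix.fromBlocks_mulVec]
  simp only [Matrix.mul_zero, Matrix.zero_mul, neg_zero, Matrix.zero_mulVec,
    zero_add, add_zero]
  rw [sumElim_dotProduct_sumElim]
  rfl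

/-- Antitonicity of the inverse in the Loewner order. -/
lemma inv_dotProduct_le {n : Type*} [Fintype n] [DecidableEq n] {A B : Matrix n n ℝ} {c : ℝ}
    (hA : A.PosDef) (hB : B.PosDef) (hc : 0 < c)
    (h : ∀ z, z ⬝ᵥ A.mulVec z ≤ c * (z ⬝ᵥ B.mulVec z)) (v : n → ℝ) :
    B⁻¹.mulVec v ⬝ᵥ v ≤ c * (A⁻¹.mulVec v ⬝ᵥ v) := by
  set z := B⁻¹.mulVec v with hz
  set w := A⁻¹.mulVec v with hw
  have hAw : A.mulVec w = v := by
    rw [hw, Matrix.mulVec_mulVec, Matrix.mul_nonsing_inv _ ((Matrix.isUnit_iff_isUnit_det _).1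
      hA.isUnit), Matrix.one_mulVec]
  have hBz : B.mulVec z = v := by
    rw [hz, Matrix.mulVec_mulVec, Matrix.mul_nonsing_inv _ ((Matrix.isUnit_iff_isUnit_det _).1
      hB.isUnit), Matrix.one_mulVec]
  have hsymm : w ⬝ᵥ A.mulVec z = z ⬝ᵥ v := by
    rw [Matrix.dotProduct_mulVec, ← Matrix.mulVec_transpose, ← Matrix.conjTranspose_eq_transpose_of_trivial,
      hA.isHermitian.eq, hAw, dotProduct_comm]
  have h0 := hA.posSemidef.dotProduct_mulVec_nonneg (w - c⁻¹ • z)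
  rw [star_trivial, Matrix.mulVec_sub, Matrix.mulVec_smul, sub_dotProduct, dotProduct_sub,
    dotProduct_sub, smul_dotProduct, smul_dotProduct, dotProduct_smul, dotProduct_smul, hsymm,
    hAw] at h0
  have h1 := h z
  rw [hBz] at h1
  simp only [smul_eq_mul] at h0
  have h2 : c⁻¹ * (c⁻¹ * (z ⬝ᵥ A.mulVec z)) ≤ c⁻¹ * (z ⬝ᵥ v) := by
    gcongr
    rwa [inv_mul_le_iff₀ hc]
  have h3 : c⁻¹ * (z ⬝ᵥ v) ≤ w ⬝ᵥ v := by linarith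
  rwa [inv_mul_le_iff₀ hc] at h3

open scoped MatrixOrder in
/-- Monotonicity of the determinant in the Loewner order. -/
lemma det_le_pow_mul_det {n : Type*} [Fintype n] [DecidableEq n] {A B : Matrix n n ℝ} {c : ℝ}
    (hA : A.PosSemidef) (hB : B.PosDef)
    (h : ∀ z, z ⬝ᵥ A.mulVec z ≤ c * (z ⬝ᵥ B.mulVec z)) :
    A.det ≤ c ^ Fintype.card n * B.det := by
  obtain ⟨L, hL⟩ := CStarAlgebra.nonneg_iff_eq_star_mul_self.mp hB.posSemidef.nonneg
  rw [Matrix.star_eq_conjTranspose] at hL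
  have hdet : B.det = L.det ^ 2 := by
    rw [hL, Matrix.det_mul, Matrix.det_conjTranspose, star_trivial, pow_two]
  have hL0 : L.det ≠ 0 := by
    intro h0
    rw [h0] at hdet
    exact hB.det_pos.ne' (by simpa using hdet)
  have hLu : IsUnit L.det := isUnit_iff_ne_zero.2 hL0
  have hM : (L⁻¹.conjTranspose * A * L⁻¹).PosSemidef := hA.conjTranspose_mul_mul_same _
  have hform : ∀ z, z ⬝ᵥ (L⁻¹.conjTranspose * A * L⁻¹).mulVec z =
      L⁻¹.mulVec z ⬝ᵥ A.mulVec (L⁻¹.mulVec z) := by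
    intro z
    rw [← Matrix.mulVec_mulVec, ← Matrix.mulVec_mulVec, Matrix.dotProduct_mulVec,
      ← Matrix.mulVec_transpose, Matrix.conjTranspose_eq_transpose_of_trivial,
      Matrix.transpose_transpose]
  have hformB : ∀ z, L⁻¹.mulVec z ⬝ᵥ B.mulVec (L⁻¹.mulVec z) = z ⬝ᵥ z := by
    intro z
    rw [hL, ← Matrix.mulVec_mulVec, Matrix.mulVec_mulVec z L, Matrix.mul_nonsing_inv _ hLu,
      Matrix.one_mulVec, Matrix.dotProduct_mulVec, ← Matrix.mulVec_transpose,
      Matrix.conjTranspose_eq_transpose_of_trivial, Matrix.transpose_transpose,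
      Matrix.mulVec_mulVec, Matrix.mul_nonsing_inv _ hLu, Matrix.one_mulVec]
  have heig : ∀ i, hM.1.eigenvalues i ≤ c := by
    intro i
    rw [hM.1.eigenvalues_eq, RCLike.re_to_real, star_trivial, hform]
    refine (h _).trans ?_
    rw [hformB]
    have h1 := hM.1.eigenvectorBasis.orthonormal.1 i
    have h2 : (hM.1.eigenvectorBasis i : n → ℝ) ⬝ᵥ (hM.1.eigenvectorBasis i : n → ℝ) = 1 := by
      have h3 := EuclideanSpace.real_norm_sq_eq (hM.1.eigenvectorBasis i)
      rw [h1, one_pow] at h3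
      simp only [dotProduct, ← pow_two]
      exact h3.symm
    rw [h2, mul_one]
  have hdetM : (L⁻¹.conjTranspose * A * L⁻¹).det ≤ c ^ Fintype.card n := by
    rw [hM.1.det_eq_prod_eigenvalues, ← Finset.card_univ, ← Finset.prod_const]
    exact Finset.prod_le_prod (fun i _ => hM.eigenvalues_nonneg i) fun i _ => heig i
  have hinv : L⁻¹.det * L.det = 1 := by
    rw [← Matrix.det_mul, Matrix.nonsing_inv_mul _ hLu, Matrix.det_one]
  have e : A.det = (L⁻¹.conjTranspose * A * L⁻¹).det * B.det := by
    rw [Matrix.det_mul, Matrix.det_mul, Matrix.det_conjTranspose, star_trivial, hdet]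
    linear_combination -A.det * (L⁻¹.det * L.det + 1) * hinv
  rw [e]
  exact mul_le_mul_of_nonneg_right hdetM hB.det_pos.le

lemma exists_dotProduct_mulVec_le {n : Type*} [Fintype n] (A : Matrix n n ℝ) :
    ∃ C : ℝ, 0 < C ∧ ∀ z, z ⬝ᵥ A.mulVec z ≤ C * (z ⬝ᵥ z) := by
  refine ⟨(∑ p, ∑ q, |A p q|) + 1, by positivity, fun z => ?_⟩
  have hz : ∀ p, z p ^ 2 ≤ z ⬝ᵥ z := by
    intro p
    simp only [dotProduct, ← pow_two]
    exact Finset.single_le_sum (f := fun p => z p ^ 2) (fun _ _ => sq_nonneg _) (Finset.mem_univ p)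
  have hz0 : 0 ≤ z ⬝ᵥ z := Finset.sum_nonneg fun p _ => mul_self_nonneg _
  have hterm : ∀ p q, z p * (A p q * z q) ≤ |A p q| * (z ⬝ᵥ z) := by
    intro p q
    have h1 : |z p * z q| ≤ z ⬝ᵥ z := by
      rw [abs_le]
      constructor <;> nlinarith [hz p, hz q, sq_nonneg (z p + z q), sq_nonneg (z p - z q)]
    calc z p * (A p q * z q) = A p q * (z p * z q) := by ring
      _ ≤ |A p q * (z p * z q)| := le_abs_self _
      _ = |A p q| * |z p * z q| := abs_mul _ _
      _ ≤ _ := by gcongr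
  have hsum : z ⬝ᵥ A.mulVec z ≤ (∑ p, ∑ q, |A p q|) * (z ⬝ᵥ z) := by
    rw [Finset.sum_mul]
    refine Finset.sum_le_sum fun p _ => ?_
    rw [Finset.sum_mul, Matrix.mulVec, dotProduct, Finset.mul_sum]
    exact Finset.sum_le_sum fun q _ => hterm p q
  linarith

lemma continuous_jetForm {ι : Type*} [Fintype ι] [DecidableEq ι]
    (A : Matrix (ι × Fin 2) (ι × Fin 2) ℝ) : Continuous (jetForm A) := by
  have : Continuous (jetVec : (ι → ℝ) → ι × Fin 2 → ℝ) := by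
    refine continuous_pi fun p => ?_
    unfold jetVec
    split_ifs <;> fun_prop
  unfold jetForm
  exact (continuous_const.matrix_mulVec this).dotProduct this

lemma integrable_kacRice {ι : Type*} [Fintype ι] [DecidableEq ι]
    {A : Matrix (ι × Fin 2) (ι × Fin 2) ℝ} (hA : A.PosDef) :
    Integrable fun η : ι → ℝ => (∏ i, |η i|) * Real.exp (-(1 / 2) * jetForm A η) := by
  obtain ⟨C, hC, h⟩ := exists_dotProduct_mulVec_le A
  have hform : ∀ η : ι → ℝ, ∑ i, η i ^ 2 ≤ C * jetForm A η := by
    intro η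
    have := inv_dotProduct_le hA Matrix.PosDef.one hC (by simpa using h) (jetVec η)
    refine le_trans (le_of_eq ?_) this
    simp [dotProduct, Fintype.sum_prod_type, jetVec, pow_two]
  have h1 : Integrable fun t : ℝ => |t| * Real.exp (-(1 / 2 * C⁻¹) * t ^ 2) := by
    have := (integrable_mul_exp_neg_mul_sq (b := 1 / 2 * C⁻¹) (by positivity)).norm
    simpa [abs_mul] using this
  have h2 : Integrable fun η : ι → ℝ =>
      ∏ i, |η i| * Real.exp (-(1 / 2 * C⁻¹) * η i ^ 2) :=
    Integrable.fintype_prod (f := fun _ t => |t| * Real.exp (-(1 / 2 * C⁻¹) * t ^ 2))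
      (μ := fun _ => volume) fun _ => h1
  have hcont := continuous_jetForm A
  refine h2.mono' (Continuous.aestronglyMeasurable (by fun_prop))
    (Filter.Eventually.of_forall fun η => ?_)
  have hp : 0 ≤ ∏ i, |η i| := Finset.prod_nonneg fun i _ => abs_nonneg _
  rw [Real.norm_of_nonneg (by positivity), Finset.prod_mul_distrib, ← Real.exp_sum,
    ← Finset.mul_sum]
  gcongr (∏ i, |η i|) * Real.exp ?_
  have := hform η
  rw [← inv_mul_le_iff₀ hC] at this
  linarith

lemma kacRice_pos {ι : Type*} [Fintype ι] [DecidableEq ι]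
    {A : Matrix (ι × Fin 2) (ι × Fin 2) ℝ} (hA : A.PosDef) : 0 < kacRice A := by
  have hcont := continuous_jetForm A
  refine mul_pos (inv_pos.2 (Real.sqrt_pos.2 (abs_pos.2 hA.det_pos.ne'))) ?_
  refine integral_pos_of_integrable_nonneg_nonzero (x := fun _ => 1) (by fun_prop)
    (integrable_kacRice hA) (fun η => ?_) ?_
  · exact mul_nonneg (Finset.prod_nonneg fun i _ => abs_nonneg _) (Real.exp_pos _).le
  · simp

/-- Kac–Rice densities of comparable covariance matrices are comparable. -/
lemma kacRice_le {ι : Type*} [Fintype ι] [DecidableEq ι]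
    {A B : Matrix (ι × Fin 2) (ι × Fin 2) ℝ} (hA : A.PosDef) (hB : B.PosDef) {a b : ℝ}
    (ha : 0 < a) (hb : 0 < b) (hAB : ∀ z, z ⬝ᵥ A.mulVec z ≤ a * (z ⬝ᵥ B.mulVec z))
    (hBA : ∀ z, z ⬝ᵥ B.mulVec z ≤ b * (z ⬝ᵥ A.mulVec z)) :
    kacRice A ≤ (a * b) ^ Fintype.card ι * kacRice B := by
  have hdet := det_le_pow_mul_det hB.posSemidef hA hBA
  have hA0 := hA.det_pos
  have hB0 := hB.det_pos
  have hcard : Fintype.card (ι × Fin 2) = Fintype.card ι * 2 := by simp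
  have hfirst : (Real.sqrt |A.det|)⁻¹ ≤ b ^ Fintype.card ι * (Real.sqrt |B.det|)⁻¹ := by
    rw [abs_of_pos hA0, abs_of_pos hB0, ← div_eq_mul_inv,
      inv_le_iff_one_le_mul₀ (Real.sqrt_pos.2 hA0), div_mul_eq_mul_div,
      one_le_div (Real.sqrt_pos.2 hB0), Real.sqrt_le_left (by positivity), mul_pow,
      Real.sq_sqrt hA0.le, ← pow_mul, ← hcard]
    exact hdet
  have hscale : ∫ η : ι → ℝ, (∏ i, |η i|) * Real.exp (-(1 / 2) * (a⁻¹ * jetForm B η)) =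
      a ^ Fintype.card ι * ∫ η : ι → ℝ, (∏ i, |η i|) * Real.exp (-(1 / 2) * jetForm B η) := by
    have hs : 0 < Real.sqrt a := Real.sqrt_pos.2 ha
    have h1 := Measure.integral_comp_smul (volume : Measure (ι → ℝ))
      (fun η => (∏ i, |η i|) * Real.exp (-(1 / 2) * (a⁻¹ * jetForm B η))) (Real.sqrt a)
    have h2 : ∀ η : ι → ℝ, jetForm B (Real.sqrt a • η) = a * jetForm B η := by
      intro η
      have : jetVec (Real.sqrt a • η) = Real.sqrt a • jetVec η := by
        funext p
        simp only [jetVec, Pi.smul_apply, smul_eq_mul]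
        split_ifs <;> simp
      rw [jetForm, this, Matrix.mulVec_smul, smul_dotProduct, dotProduct_smul, smul_smul,
        Real.mul_self_sqrt ha.le]
      rfl
    have h3 : ∀ η : ι → ℝ, ∏ i, |(Real.sqrt a • η) i| =
        Real.sqrt a ^ Fintype.card ι * ∏ i, |η i| := by
      intro η
      simp only [Pi.smul_apply, smul_eq_mul, abs_mul, abs_of_pos hs, Finset.prod_mul_distrib,
        Finset.prod_const, Finset.card_univ]
    simp only [h2, h3, inv_mul_cancel_left₀ ha.ne', mul_assoc] at h1
    rw [integral_const_mul, Module.finrank_fintype_fun_eq_card, abs_of_pos (by positivity),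
      smul_eq_mul, eq_inv_mul_iff_mul_eq₀ (by positivity), ← mul_assoc, ← mul_pow,
      Real.mul_self_sqrt ha.le] at h1
    exact h1.symm
  have hsecond : ∫ η : ι → ℝ, (∏ i, |η i|) * Real.exp (-(1 / 2) * jetForm A η) ≤
      ∫ η : ι → ℝ, (∏ i, |η i|) * Real.exp (-(1 / 2) * (a⁻¹ * jetForm B η)) := by
    refine integral_mono (integrable_kacRice hA) ?_ fun η => ?_
    · by_contra hni
      have := hscale
      rw [integral_undef hni] at this
      have hB1 := kacRice_pos hB
      rw [kacRice] at hB1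
      have hpos := (mul_pos_iff_of_pos_left
        (inv_pos.2 (Real.sqrt_pos.2 (abs_pos.2 hB0.ne')))).1 hB1
      have : 0 < a ^ Fintype.card ι *
        ∫ η : ι → ℝ, (∏ i, |η i|) * Real.exp (-(1 / 2) * jetForm B η) := by positivity
      linarith
    · have := inv_dotProduct_le hA hB ha hAB (jetVec η)
      have hle : a⁻¹ * jetForm B η ≤ jetForm A η := by
        rwa [inv_mul_le_iff₀ ha]
      have hp : 0 ≤ ∏ i, |η i| := Finset.prod_nonneg fun i _ => abs_nonneg _
      dsimp only
      gcongr (∏ i, |η i|) * Real.exp ?_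
      linarith
  have hI0 : 0 ≤ ∫ η : ι → ℝ, (∏ i, |η i|) * Real.exp (-(1 / 2) * jetForm A η) :=
    integral_nonneg fun η =>
      mul_nonneg (Finset.prod_nonneg fun i _ => abs_nonneg _) (Real.exp_pos _).le
  calc kacRice A ≤ (b ^ Fintype.card ι * (Real.sqrt |B.det|)⁻¹) * (a ^ Fintype.card ι *
        ∫ η : ι → ℝ, (∏ i, |η i|) * Real.exp (-(1 / 2) * jetForm B η)) :=
        mul_le_mul hfirst (hsecond.trans_eq hscale) hI0 (by positivity)
    _ = (a * b) ^ Fintype.card ι * kacRice B := by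
        rw [kacRice, mul_pow]; ring

lemma weylFun_sum {ι κ : Type*} [Fintype ι] [Fintype κ] (x : ι ⊕ κ → ℝ)
    (z : (ι ⊕ κ) × Fin 2 → ℝ) (y : ℝ) :
    weylFun x z y = weylFun (x ∘ Sum.inl) (fun p => z (Sum.inl p.1, p.2)) y +
      weylFun (x ∘ Sum.inr) (fun p => z (Sum.inr p.1, p.2)) y := by
  simp only [weylFun, Fintype.sum_prod_type, Fintype.sum_sum_type, Function.comp_apply]

/-- The covariance matrix of two independent families of jets. -/
def weylBlock {ι κ : Type*} (u : ι → ℝ) (v : κ → ℝ) :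
    Matrix ((ι ⊕ κ) × Fin 2) ((ι ⊕ κ) × Fin 2) ℝ :=
  (Matrix.fromBlocks (weylGram u) 0 0 (weylGram v)).submatrix
    (Equiv.sumProdDistrib ι κ (Fin 2)) (Equiv.sumProdDistrib ι κ (Fin 2))

lemma weylBlock_dotProduct {ι κ : Type*} [Fintype ι] [Fintype κ] (u : ι → ℝ) (v : κ → ℝ)
    (z : (ι ⊕ κ) × Fin 2 → ℝ) :
    Real.sqrt (Real.pi / 2) * (z ⬝ᵥ (weylBlock u v).mulVec z) =
      (∫ y, weylFun u (fun p => z (Sum.inl p.1, p.2)) y ^ 2) +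
        ∫ y, weylFun v (fun p => z (Sum.inr p.1, p.2)) y ^ 2 := by
  rw [integral_weylFun_sq, integral_weylFun_sq, ← mul_add, weylBlock,
    Matrix.submatrix_mulVec_equiv]
  congr 1
  have h2 : z ∘ (Equiv.sumProdDistrib ι κ (Fin 2)).symm =
      Sum.elim (fun p => z (Sum.inl p.1, p.2)) (fun p => z (Sum.inr p.1, p.2)) := by
    funext p
    rcases p with p | p <;> rfl
  rw [h2, Matrix.fromBlocks_mulVec, ← comp_equiv_symm_dotProduct, h2]
  simp only [Function.comp_def, Sum.elim_inl, Sum.elim_inr, Matrix.zero_mulVec, zero_add, add_zero]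
  rw [sumElim_dotProduct_sumElim]

lemma weylGram_dotProduct {ι κ : Type*} [Fintype ι] [Fintype κ] (x : ι ⊕ κ → ℝ)
    (z : (ι ⊕ κ) × Fin 2 → ℝ) :
    Real.sqrt (Real.pi / 2) * (z ⬝ᵥ (weylGram x).mulVec z) =
      (∫ y, weylFun (x ∘ Sum.inl) (fun p => z (Sum.inl p.1, p.2)) y ^ 2) +
        2 * (∫ y, weylFun (x ∘ Sum.inl) (fun p => z (Sum.inl p.1, p.2)) y *
          weylFun (x ∘ Sum.inr) (fun p => z (Sum.inr p.1, p.2)) y) +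
        ∫ y, weylFun (x ∘ Sum.inr) (fun p => z (Sum.inr p.1, p.2)) y ^ 2 := by
  rw [← integral_weylFun_sq]
  simp only [weylFun_sum x z]
  set f := weylFun (x ∘ Sum.inl) (fun p => z (Sum.inl p.1, p.2))
  set g := weylFun (x ∘ Sum.inr) (fun p => z (Sum.inr p.1, p.2))
  have hf : Integrable fun y => f y ^ 2 := by
    simpa only [pow_two] using integrable_weylFun_mul (x ∘ Sum.inl) (x ∘ Sum.inl) _ _
  have hg : Integrable fun y => g y ^ 2 := by
    simpa only [pow_two] using integrable_weylFun_mul (x ∘ Sum.inr) (x ∘ Sum.inr) _ _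
  have hfg : Integrable fun y => 2 * (f y * g y) := (integrable_weylFun_mul _ _ _ _).const_mul _
  have hfs : Integrable fun y => f y ^ 2 + 2 * (f y * g y) := hf.add hfg
  rw [← integral_const_mul, ← integral_add hf hfg, ← integral_add hfs hg]
  congr 1
  funext y
  ring

lemma isHermitian_weylBlock {ι κ : Type*} (u : ι → ℝ) (v : κ → ℝ) :
    (weylBlock u v).IsHermitian :=
  ((isHermitian_weylGram u).fromBlocks (by simp) (isHermitian_weylGram v)).submatrix _

/-- Almost orthogonality of the two families gives approximate factorisation of the density. -/
lemma kacRice_weylGram_le_and_le {ι κ : Type} [Fintype ι] [DecidableEq ι] [Fintype κ]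
    [DecidableEq κ] {x : ι ⊕ κ → ℝ} (hx : Function.Injective x) {ε : ℝ} (hε0 : 0 ≤ ε)
    (hε1 : ε < 1)
    (h : ∀ z w, 2 * |∫ y, weylFun (x ∘ Sum.inl) z y * weylFun (x ∘ Sum.inr) w y| ≤
      ε * ((∫ y, weylFun (x ∘ Sum.inl) z y ^ 2) + ∫ y, weylFun (x ∘ Sum.inr) w y ^ 2)) :
    kacRice (weylGram x) ≤ ((1 + ε) * (1 - ε)⁻¹) ^ Fintype.card (ι ⊕ κ) *
        (kacRice (weylGram (x ∘ Sum.inl)) * kacRice (weylGram (x ∘ Sum.inr))) ∧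
      kacRice (weylGram (x ∘ Sum.inl)) * kacRice (weylGram (x ∘ Sum.inr)) ≤
        ((1 + ε) * (1 - ε)⁻¹) ^ Fintype.card (ι ⊕ κ) * kacRice (weylGram x) := by
  have hc : 0 < Real.sqrt (Real.pi / 2) := by positivity
  have hG := posDef_weylGram hx
  have hAB : ∀ z, z ⬝ᵥ (weylGram x).mulVec z ≤
      (1 + ε) * (z ⬝ᵥ (weylBlock (x ∘ Sum.inl) (x ∘ Sum.inr)).mulVec z) := by
    intro z
    refine le_of_mul_le_mul_left ?_ hc
    rw [mul_left_comm, weylBlock_dotProduct, weylGram_dotProduct]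
    have h1 := h (fun p => z (Sum.inl p.1, p.2)) (fun p => z (Sum.inr p.1, p.2))
    linarith [le_abs_self (∫ y, weylFun (x ∘ Sum.inl) (fun p => z (Sum.inl p.1, p.2)) y *
      weylFun (x ∘ Sum.inr) (fun p => z (Sum.inr p.1, p.2)) y)]
  have hBA : ∀ z, z ⬝ᵥ (weylBlock (x ∘ Sum.inl) (x ∘ Sum.inr)).mulVec z ≤
      (1 - ε)⁻¹ * (z ⬝ᵥ (weylGram x).mulVec z) := by
    intro z
    rw [← div_eq_inv_mul, le_div_iff₀' (by linarith)]
    refine le_of_mul_le_mul_left ?_ hc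
    rw [mul_left_comm, weylBlock_dotProduct, weylGram_dotProduct]
    have h1 := h (fun p => z (Sum.inl p.1, p.2)) (fun p => z (Sum.inr p.1, p.2))
    linarith [neg_abs_le (∫ y, weylFun (x ∘ Sum.inl) (fun p => z (Sum.inl p.1, p.2)) y *
      weylFun (x ∘ Sum.inr) (fun p => z (Sum.inr p.1, p.2)) y)]
  have hB : (weylBlock (x ∘ Sum.inl) (x ∘ Sum.inr)).PosDef := by
    refine Matrix.PosDef.of_dotProduct_mulVec_pos (isHermitian_weylBlock _ _) fun z hz => ?_
    have h1 := hG.dotProduct_mulVec_pos hz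
    rw [star_trivial] at h1 ⊢
    exact (mul_pos_iff_of_pos_left (by linarith)).1 (h1.trans_le (hAB z))
  have hprod : kacRice (weylBlock (x ∘ Sum.inl) (x ∘ Sum.inr)) =
      kacRice (weylGram (x ∘ Sum.inl)) * kacRice (weylGram (x ∘ Sum.inr)) :=
    kacRice_fromBlocks (posDef_weylGram (hx.comp Sum.inl_injective)).isUnit
      (posDef_weylGram (hx.comp Sum.inr_injective)).isUnit
  have hp : 0 < 1 + ε := by linarith
  have hm : 0 < (1 - ε)⁻¹ := inv_pos.2 (by linarith)
  rw [← hprod]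
  refine ⟨kacRice_le hG hB hp hm hAB hBA, ?_⟩
  rw [mul_comm (1 + ε)]
  exact kacRice_le hB hG hm hp hBA hAB

lemma one_add_pow_le_of_le_two {y : ℝ} (h0 : 0 ≤ y) (h2 : y ≤ 2) (n : ℕ) :
    (1 + y) ^ n ≤ 1 + 4 ^ n * y := by
  induction n with
  | zero => simpa using h0
  | succ n ih =>
    have h4 : (1 : ℝ) ≤ 4 ^ n := one_le_pow₀ (by norm_num)
    calc (1 + y) ^ (n + 1) = (1 + y) ^ n * (1 + y) := pow_succ _ _
      _ ≤ (1 + 4 ^ n * y) * (1 + y) := by gcongr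
      _ ≤ 1 + 4 ^ (n + 1) * y := by
        rw [pow_succ]
        nlinarith [mul_nonneg h0 (sub_nonneg.2 h2), mul_nonneg h0 (sub_nonneg.2 h4),
          mul_nonneg (mul_nonneg h0 (sub_nonneg.2 h2)) (zero_le_one.trans h4)]

lemma abs_div_sub_one_le {S T ε : ℝ} (hS : 0 < S) (hT : 0 < T) (hε0 : 0 ≤ ε) (hε : ε ≤ 1 / 2)
    (n : ℕ) (h1 : T ≤ ((1 + ε) * (1 - ε)⁻¹) ^ n * S) (h2 : S ≤ ((1 + ε) * (1 - ε)⁻¹) ^ n * T) :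
    |T / S - 1| ≤ 4 ^ (n + 1) * ε := by
  have hq : (1 + ε) * (1 - ε)⁻¹ ≤ 1 + 4 * ε := by
    rw [← div_eq_mul_inv, div_le_iff₀ (by linarith)]
    nlinarith
  have hq0 : 0 ≤ (1 + ε) * (1 - ε)⁻¹ :=
    mul_nonneg (by linarith) (inv_nonneg.2 (by linarith))
  have hr : ((1 + ε) * (1 - ε)⁻¹) ^ n ≤ 1 + 4 ^ (n + 1) * ε := by
    refine (pow_le_pow_left₀ hq0 hq n).trans ((one_add_pow_le_of_le_two (by linarith)
      (by linarith) n).trans_eq ?_)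
    ring
  set r := ((1 + ε) * (1 - ε)⁻¹) ^ n
  have hle : T / S ≤ r := by rwa [div_le_iff₀ hS]
  have hge : 1 ≤ r * (T / S) := by
    rw [← mul_div_assoc, le_div_iff₀ hS, one_mul]; exact h2
  have hpos : 0 < T / S := div_pos hT hS
  rw [abs_le]
  constructor
  · nlinarith [sq_nonneg (T / S - 1)]
  · linarith

/-- A partition of `Fin k` into two sets, as an equivalence with a sum type. -/
lemma exists_sum_equiv_of_partition {k : ℕ} (I J : Finset (Fin k)) (hd : Disjoint I J)
    (hu : I ∪ J = Finset.univ) : ∃ e : Fin I.card ⊕ Fin J.card ≃ Fin k,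
      (∀ i, e (Sum.inl i) = I.orderEmbOfFin rfl i) ∧
        ∀ j, e (Sum.inr j) = J.orderEmbOfFin rfl j := by
  refine ⟨Equiv.ofBijective (Sum.elim (I.orderEmbOfFin rfl) (J.orderEmbOfFin rfl)) ⟨?_, ?_⟩,
    fun i => rfl, fun j => rfl⟩
  · refine Function.Injective.sumElim (I.orderEmbOfFin rfl).injective
      (J.orderEmbOfFin rfl).injective fun i j hij => ?_
    exact Finset.disjoint_left.1 hd (I.orderEmbOfFin_mem rfl i)
      (hij ▸ J.orderEmbOfFin_mem rfl j)
  · intro a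
    rcases Finset.mem_union.1 (hu ▸ Finset.mem_univ a) with h | h
    · obtain ⟨i, hi⟩ : a ∈ Set.range (I.orderEmbOfFin rfl) := by
        rw [Finset.range_orderEmbOfFin]; exact h
      exact ⟨Sum.inl i, hi⟩
    · obtain ⟨j, hj⟩ : a ∈ Set.range (J.orderEmbOfFin rfl) := by
        rw [Finset.range_orderEmbOfFin]; exact h
      exact ⟨Sum.inr j, hj⟩

/-- The constants of almost orthogonality can be chosen uniformly in the sizes of the clusters. -/
lemma exists_uniform_abs_integral_weylFun_mul_le (k : ℕ) : ∃ K : ℝ, 1 ≤ K ∧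
    ∀ {ι κ : Type} [Fintype ι] [Fintype κ] [Nonempty ι] [Nonempty κ], Fintype.card ι ≤ k →
      Fintype.card κ ≤ k → ∀ (x : ι → ℝ) (x' : κ → ℝ) (d : ℝ), 1 ≤ d →
      (∀ i j, d ≤ |x i - x' j|) → ∀ (z : ι × Fin 2 → ℝ) (w : κ × Fin 2 → ℝ),
      2 * |∫ y, weylFun x z y * weylFun x' w y| ≤ K * Real.exp (-(d - 1) ^ 2 / 2) *
        ((∫ y, weylFun x z y ^ 2) + ∫ y, weylFun x' w y ^ 2) := by
  choose K hK h using exists_abs_integral_weylFun_mul_le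
  refine ⟨1 + ∑ a ∈ Finset.range (k + 1), ∑ b ∈ Finset.range (k + 1), K a b, ?_, ?_⟩
  · have : 0 ≤ ∑ a ∈ Finset.range (k + 1), ∑ b ∈ Finset.range (k + 1), K a b :=
      Finset.sum_nonneg fun a _ => Finset.sum_nonneg fun b _ => (hK a b).le
    linarith
  · intro ι κ _ _ _ _ hι hκ x x' d hd hdist z w
    refine (h _ _ rfl rfl x x' d hd hdist z w).trans ?_
    have h1 : 0 ≤ ∫ y, weylFun x z y ^ 2 := integral_nonneg fun t => sq_nonneg _
    have h2 : 0 ≤ ∫ y, weylFun x' w y ^ 2 := integral_nonneg fun t => sq_nonneg _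
    have h3 : K (Fintype.card ι) (Fintype.card κ) ≤
        ∑ a ∈ Finset.range (k + 1), ∑ b ∈ Finset.range (k + 1), K a b := by
      refine le_trans ?_ (Finset.single_le_sum (f := fun a => ∑ b ∈ Finset.range (k + 1), K a b)
        (fun a _ => Finset.sum_nonneg fun b _ => (hK a b).le)
        (Finset.mem_range.2 (Nat.lt_succ_of_le hι)))
      exact Finset.single_le_sum (f := fun b => K (Fintype.card ι) b) (fun b _ => (hK _ b).le)
        (Finset.mem_range.2 (Nat.lt_succ_of_le hκ))
    gcongr
    linarith

/-- **Clustering of the correlation functions of real zeros of the Weyl series.**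
For every `k ≥ 1` there are `Δ_k, C_k > 0` (depending only on `k`) such that for any
distinct reals `x_1, …, x_k` and any partition `{1,…,k} = I ∪ J` into nonempty disjoint
sets with `d = min{|x_i − x_j| : i ∈ I, j ∈ J} ≥ 2Δ_k`,
`|ρ_k(X)/(ρ_{|I|}(X_I) ρ_{|J|}(X_J)) − 1| ≤ C_k exp(−(d − Δ_k)²/2)`. -/
theorem weyl_correlation_clustering :
    ∀ k : ℕ, 1 ≤ k → ∃ Δk Ck : ℝ, 0 < Δk ∧ 0 < Ck ∧
      ∀ x : Fin k → ℝ, Function.Injective x →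
      ∀ I J : Finset (Fin k), I.Nonempty → J.Nonempty → Disjoint I J →
        I ∪ J = Finset.univ →
      ∀ d : ℝ, d = sInf {r : ℝ | ∃ i ∈ I, ∃ j ∈ J, r = |x i - x j|} →
        2 * Δk ≤ d →
        |weylRho k x /
            (weylRho I.card (fun i => x (I.orderEmbOfFin rfl i)) *
              weylRho J.card (fun j => x (J.orderEmbOfFin rfl j))) - 1| ≤
          Ck * Real.exp (-(d - Δk) ^ 2 / 2) := by
  intro k _
  obtain ⟨K, hK1, hK⟩ := exists_uniform_abs_integral_weylFun_mul_le k
  refine ⟨1 + 4 * K, 4 ^ (k + 1) * K, by linarith, by positivity, ?_⟩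
  intro x hx I J hI hJ hIJ hU d hd hΔd
  obtain ⟨e, hel, her⟩ := exists_sum_equiv_of_partition I J hIJ hU
  have hdist : ∀ i ∈ I, ∀ j ∈ J, d ≤ |x i - x j| := by
    intro i hi j hj
    rw [hd]
    refine csInf_le ⟨0, ?_⟩ ⟨i, hi, j, hj, rfl⟩
    rintro r ⟨a, -, b, -, rfl⟩
    exact abs_nonneg _
  have hIk : Fintype.card (Fin I.card) ≤ k := by
    simpa using Finset.card_le_univ I
  have hJk : Fintype.card (Fin J.card) ≤ k := by
    simpa using Finset.card_le_univ J
  have : Nonempty (Fin I.card) := ⟨⟨0, hI.card_pos⟩⟩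
  have : Nonempty (Fin J.card) := ⟨⟨0, hJ.card_pos⟩⟩
  have hxe : Function.Injective (x ∘ e) := hx.comp e.injective
  set ε := K * Real.exp (-(d - 1) ^ 2 / 2) with hε
  have hε0 : 0 ≤ ε := by positivity
  have hεle : ε ≤ K * Real.exp (-(d - (1 + 4 * K)) ^ 2 / 2) := by
    rw [hε]
    gcongr _ * Real.exp ?_
    nlinarith
  have hεhalf : ε ≤ 1 / 2 := by
    have h1 : 1 + (d - 1) ^ 2 / 2 ≤ Real.exp ((d - 1) ^ 2 / 2) := by
      linarith [Real.add_one_le_exp ((d - 1) ^ 2 / 2)]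
    have h2 : 2 * K ≤ Real.exp ((d - 1) ^ 2 / 2) := by nlinarith
    rw [hε, neg_div, Real.exp_neg, ← div_eq_mul_inv, div_le_div_iff₀ (Real.exp_pos _) two_pos]
    linarith
  obtain ⟨hle, hge⟩ := kacRice_weylGram_le_and_le hxe hε0 (by linarith) (fun z w =>
    hK hIk hJk ((x ∘ e) ∘ Sum.inl) ((x ∘ e) ∘ Sum.inr) d (by linarith) (fun i j => by
      simp only [Function.comp_apply, hel, her]
      exact hdist _ (I.orderEmbOfFin_mem rfl i) _ (J.orderEmbOfFin_mem rfl j)) z w)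
  have hcard : Fintype.card (Fin I.card ⊕ Fin J.card) = k := by
    rw [Fintype.card_congr e, Fintype.card_fin]
  have hcard' : I.card + J.card = k := by simpa using hcard
  have hGe : kacRice (weylGram (x ∘ e)) = kacRice (weylGram x) := kacRice_submatrix e (weylGram x)
  have hxl : (x ∘ e) ∘ Sum.inl = fun i => x (I.orderEmbOfFin rfl i) := funext fun i => by
    simp [hel]
  have hxr : (x ∘ e) ∘ Sum.inr = fun j => x (J.orderEmbOfFin rfl j) := funext fun j => by
    simp [her]
  have hl0 := kacRice_pos (posDef_weylGram (hxe.comp Sum.inl_injective))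
  have hr0 := kacRice_pos (posDef_weylGram (hxe.comp Sum.inr_injective))
  rw [hxl] at hl0
  rw [hxr] at hr0
  rw [hGe, hxl, hxr, hcard] at hle hge
  have hratio : weylRho k x / (weylRho I.card (fun i => x (I.orderEmbOfFin rfl i)) *
      weylRho J.card (fun j => x (J.orderEmbOfFin rfl j))) = kacRice (weylGram x) /
      (kacRice (weylGram fun i => x (I.orderEmbOfFin rfl i)) *
        kacRice (weylGram fun j => x (J.orderEmbOfFin rfl j))) := by
    have hpi : ((2 * Real.pi) ^ k)⁻¹ ≠ 0 := by positivity
    rw [weylRho_eq_kacRice, weylRho_eq_kacRice, weylRho_eq_kacRice, mul_mul_mul_comm, ← mul_inv,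
      ← pow_add, hcard', mul_div_mul_left _ _ hpi]
  rw [hratio]
  refine (abs_div_sub_one_le (mul_pos hl0 hr0) (kacRice_pos (posDef_weylGram hx)) hε0 hεhalf k
    hle hge).trans ?_
  rw [mul_assoc]
  gcongr

end
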